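/- arXiv:1905.03015 — 4 statements merged into one kernel-verified Lean document; each statement's English description precedes it below -/
import Mathlib

section
/- Let M be a discrete random variable taking values in the finite set {m_1, …, m_k} of reals, with minimum spacing α_m = min_{i≠j} |m_i − m_j|. Let T be a real-valued random variable independent of M, absolutely continuous with respect to Lebesgue measure, with finite differential entropy, and satisfying |T| < α_m/2 almost surely. Then M + T is absolutely continuous and its differential entropy satisfies h(M+T) = H(M) + h(T). -/
open MeasureTheory ProbabilityTheory Real

/-- Discrete (Shannon) entropy of a real-valued discrete random variable,
`H(X) = -∑ₓ P(X = x) log P(X = x)` (natural logarithm). -/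
noncomputable def dEnt {Ω : Type*} [MeasurableSpace Ω] (μ : Measure Ω) (X : Ω → ℝ) : ℝ :=
  -∑' x : ℝ, ((μ (X ⁻¹' {x})).toReal * Real.log (μ (X ⁻¹' {x})).toReal)

/-- Differential entropy of a real-valued random variable, computed from its
probability density function with respect to Lebesgue measure:
`h(V) = -∫ p_V(x) log p_V(x) dx` (natural logarithm). -/
noncomputable def cEnt {Ω : Type*} [MeasurableSpace Ω] (μ : Measure Ω) (V : Ω → ℝ) : ℝ :=
  -∫ x : ℝ, (pdf V μ volume x).toReal * Real.log (pdf V μ volume x).toReal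

/-- Minimum spacing between the points of a set of reals:
`α = inf {|x - y| : x, y ∈ s, x ≠ y}`. -/
noncomputable def minSpacing (s : Set ℝ) : ℝ :=
  sInf {d : ℝ | ∃ x ∈ s, ∃ y ∈ s, x ≠ y ∧ d = |x - y|}

/-- Distinct points of a finite set of reals are at least `minSpacing` apart. -/
theorem minSpacing_le_abs_sub {s : Set ℝ} {x y : ℝ} (hx : x ∈ s) (hy : y ∈ s) (hxy : x ≠ y) :
    minSpacing s ≤ |x - y| := by
  refine csInf_le ⟨0, ?_⟩ ⟨x, hx, y, hy, hxy, rfl⟩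
  rintro d ⟨a, -, b, -, -, rfl⟩
  exact abs_nonneg _

/-- The law of the sum of an independent pair whose first component has finitely many values is
the mixture of the translated laws of the second component. -/
theorem map_add_eq_withDensity_sum
    {Ω : Type*} [MeasurableSpace Ω] (μ : Measure Ω) {M T : Ω → ℝ} (hM : Measurable M)
    (hT : Measurable T) (s : Finset ℝ) (hMs : ∀ ω, M ω ∈ s) (hindep : IndepFun M T μ)
    {f : ℝ → ENNReal} (hf : Measurable f) (hfT : μ.map T = volume.withDensity f) :
    μ.map (M + T) = volume.withDensity fun x => ∑ i ∈ s, μ (M ⁻¹' {i}) * f (x - i) := by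
  ext A hA
  have hsplit : (M + T) ⁻¹' A = ⋃ i ∈ s, M ⁻¹' {i} ∩ T ⁻¹' ((fun x => x + i) ⁻¹' A) := by
    ext ω
    simp only [Set.mem_preimage, Pi.add_apply, Set.mem_iUnion, Set.mem_inter_iff,
      Set.mem_singleton_iff, exists_prop]
    constructor
    · intro h
      exact ⟨M ω, hMs ω, rfl, by rwa [add_comm]⟩
    · rintro ⟨i, -, rfl, h⟩
      rwa [add_comm]
  have hAi (i : ℝ) : MeasurableSet ((fun x => x + i) ⁻¹' A) := measurable_add_const i hA
  rw [Measure.map_apply (hM.add hT) hA, hsplit, measure_biUnion_finset, withDensity_apply _ hA,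
    lintegral_finsetSum _ fun i _ => by fun_prop]
  · refine Finset.sum_congr rfl fun i _ => ?_
    rw [hindep.measure_inter_preimage_eq_mul _ _ (measurableSet_singleton i) (hAi i),
      lintegral_const_mul _ (by fun_prop), ← Measure.map_apply hT (hAi i), hfT,
      withDensity_apply _ (hAi i), ← lintegral_indicator (hAi i), ← lintegral_indicator hA,
      ← lintegral_sub_right_eq_self _ i]
    congr 1
    refine lintegral_congr fun x => ?_
    by_cases hx : x ∈ A <;> simp [Set.indicator, hx]
  · intro i _ j _ hij
    refine Set.disjoint_left.2 ?_
    rintro ω ⟨hi, -⟩ ⟨hj, -⟩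
    exact hij (hi.symm.trans hj)
  · exact fun i _ => (hM (measurableSet_singleton i)).inter (hT (hAi i))

/-- `u ↦ u log u` is additive along families with at most one nonzero member. -/
theorem sum_toReal_mul_log_of_pairwise_eq_zero {ι : Type*} (s : Finset ι) (u : ι → ENNReal)
    (h : ∀ i ∈ s, ∀ j ∈ s, i ≠ j → u i = 0 ∨ u j = 0) :
    (∑ i ∈ s, u i).toReal * log (∑ i ∈ s, u i).toReal
      = ∑ i ∈ s, (u i).toReal * log (u i).toReal := by
  by_cases hz : ∀ i ∈ s, u i = 0
  · rw [Finset.sum_eq_zero hz, Finset.sum_eq_zero fun i hi => by simp [hz i hi]]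
    simp
  · push Not at hz
    obtain ⟨i, hi, hui⟩ := hz
    have hu (j) (hj : j ∈ s) (hji : j ≠ i) : u j = 0 := (h j hj i hi hji).resolve_right hui
    rw [Finset.sum_eq_single_of_mem i hi hu,
      Finset.sum_eq_single_of_mem i hi fun j hj hji => by simp [hu j hj hji]]

theorem mul_mul_log_mul (a b : ℝ) :
    a * b * log (a * b) = a * log a * b + a * (b * log b) := by
  rcases eq_or_ne a 0 with rfl | ha
  · simp
  rcases eq_or_ne b 0 with rfl | hb
  · simp
  rw [log_mul ha hb]
  ring

/-- Let `M` be a discrete random variable taking values in a finite set of reals with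
minimum spacing `α_m`, and let `T` be an absolutely continuous random variable,
independent of `M`, with finite differential entropy and `|T| < α_m / 2` a.s.
Then `M + T` is absolutely continuous and `h(M + T) = H(M) + h(T)`. -/
theorem differentialEntropy_discrete_add_perturbation
    {Ω : Type*} [MeasurableSpace Ω] (μ : Measure Ω) [IsProbabilityMeasure μ]
    (M T : Ω → ℝ) (hM : Measurable M) (hT : Measurable T)
    (s : Finset ℝ) (hMs : ∀ ω, M ω ∈ s)
    (hindep : IndepFun M T μ)
    (hac : HasPDF T μ volume)
    (hfin : Integrable (fun x : ℝ =>
      (pdf T μ volume x).toReal * Real.log (pdf T μ volume x).toReal))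
    (hTsmall : ∀ᵐ ω ∂μ, |T ω| < minSpacing (↑s) / 2) :
    HasPDF (M + T) μ volume ∧ cEnt μ (M + T) = dEnt μ M + cEnt μ T := by
  set f := pdf T μ volume with hf
  have hfm : Measurable f := measurable_pdf T μ volume
  have hmapT : μ.map T = volume.withDensity f := map_eq_withDensity_pdf T μ volume
  set p : ℝ → ENNReal := fun i => μ (M ⁻¹' {i})
  have hmap := map_add_eq_withDensity_sum μ hM hT s hMs hindep hfm hmapT
  have hgm : Measurable fun x => ∑ i ∈ s, p i * f (x - i) := by fun_prop
  have hpdf : HasPDF (M + T) μ volume :=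
    hasPDF_of_map_eq_withDensity (hM.add hT).aemeasurable _ hgm.aemeasurable hmap
  refine ⟨hpdf, ?_⟩
  have hg : pdf (M + T) μ volume =ᵐ[volume] fun x => ∑ i ∈ s, p i * f (x - i) :=
    (pdf.eq_of_map_eq_withDensity _ hgm.aemeasurable).1 hmap
  have hsupp : ∀ᵐ x, minSpacing (↑s) / 2 ≤ |x| → f x = 0 := by
    have hB : MeasurableSet {x : ℝ | minSpacing (↑s) / 2 ≤ |x|} :=
      measurableSet_le measurable_const measurable_id.abs
    have h0 : μ.map T {x : ℝ | minSpacing (↑s) / 2 ≤ |x|} = 0 := by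
      rw [Measure.map_apply hT hB]
      have := ae_iff.1 hTsmall
      simpa only [not_lt, Set.preimage_ofPred_eq] using this
    rw [hmapT, withDensity_apply _ hB, setLIntegral_eq_zero_iff hB hfm] at h0
    exact h0
  have hsupp_shift : ∀ᵐ x, ∀ i ∈ s, minSpacing (↑s) / 2 ≤ |x - i| → f (x - i) = 0 := by
    rw [Filter.eventually_all_finset]
    intro i _
    exact (measurePreserving_sub_right volume i).quasiMeasurePreserving.ae hsupp
  have hp_one : ∑ i ∈ s, (p i).toReal = 1 := by
    rw [← ENNReal.toReal_sum fun i _ => measure_ne_top μ _,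
      sum_measure_preimage_singleton s fun i _ => hM (measurableSet_singleton i),
      Set.eq_univ_of_forall (s := M ⁻¹' ↑s) hMs, measure_univ, ENNReal.toReal_one]
  have hf_lint : ∫⁻ x, f x = 1 := by rw [hf, pdf.lintegral_eq_measure_univ, measure_univ]
  have hf_int : Integrable fun x => (f x).toReal :=
    integrable_toReal_of_lintegral_ne_top hfm.aemeasurable (by simp [hf_lint])
  have hf_one : ∫ x, (f x).toReal = 1 := by
    rw [integral_toReal hfm.aemeasurable pdf.ae_lt_top, hf_lint, ENNReal.toReal_one]
  have hdecomp : (fun x => (pdf (M + T) μ volume x).toReal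
        * log (pdf (M + T) μ volume x).toReal) =ᵐ[volume]
      fun x => ∑ i ∈ s, ((p i).toReal * log (p i).toReal * (f (x - i)).toReal
        + (p i).toReal * ((f (x - i)).toReal * log (f (x - i)).toReal)) := by
    filter_upwards [hg, hsupp_shift] with x hx hsx
    rw [hx, sum_toReal_mul_log_of_pairwise_eq_zero]
    · simp only [ENNReal.toReal_mul, mul_mul_log_mul]
    · intro i hi j hj hij
      rcases le_or_gt (minSpacing (↑s) / 2) |x - i| with h | h
      · left
        rw [hsx i hi h, mul_zero]
      · right
        have hsep := minSpacing_le_abs_sub (Finset.mem_coe.2 hi) (Finset.mem_coe.2 hj) hij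
        have htri := abs_sub_le i x j
        rw [abs_sub_comm i x] at htri
        rw [hsx j hj (by linarith), mul_zero]
  have hint₁ (i : ℝ) : Integrable fun x => (p i).toReal * log (p i).toReal * (f (x - i)).toReal :=
    (hf_int.comp_sub_right i).const_mul _
  have hint₂ (i : ℝ) : Integrable fun x =>
      (p i).toReal * ((f (x - i)).toReal * log (f (x - i)).toReal) :=
    (hfin.comp_sub_right i).const_mul _
  have hadd (i : ℝ) : Integrable fun x => (p i).toReal * log (p i).toReal * (f (x - i)).toReal
      + (p i).toReal * ((f (x - i)).toReal * log (f (x - i)).toReal) :=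
    (hint₁ i).add (hint₂ i)
  have hdisc : dEnt μ M = -∑ i ∈ s, (p i).toReal * log (p i).toReal := by
    rw [dEnt, tsum_eq_sum]
    intro i hi
    have hempty : M ⁻¹' {i} = ∅ := by
      refine Set.eq_empty_of_forall_notMem fun ω hω => hi ?_
      rw [← Set.mem_singleton_iff.1 hω]
      exact hMs ω
    simp [hempty]
  rw [hdisc, cEnt, cEnt, integral_congr_ae hdecomp,
    integral_finsetSum _ fun i _ => hadd i]
  have hterm (i : ℝ) : ∫ x, ((p i).toReal * log (p i).toReal * (f (x - i)).toReal
        + (p i).toReal * ((f (x - i)).toReal * log (f (x - i)).toReal))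
      = (p i).toReal * log (p i).toReal + (p i).toReal * ∫ x, (f x).toReal * log (f x).toReal := by
    rw [integral_add (hint₁ i) (hint₂ i), integral_const_mul, integral_const_mul,
      integral_sub_right_eq_self (fun x => (f x).toReal) i, hf_one, mul_one,
      integral_sub_right_eq_self (fun x => (f x).toReal * log (f x).toReal) i]
  simp only [hterm]
  rw [Finset.sum_add_distrib, ← Finset.sum_mul, hp_one, one_mul, neg_add]
end

section
/- Let X and Y be independent real-valued discrete random variables each supported on a finite set, let Z = X + Y have minimum spacing α_z, and let Λ be the set of probability density functions supported on (−α_z/4, α_z/4) with finite differential entropy. Then Nd(X+Y) / (Nd(X) + Nd(Y)) ≥ sup_{p ∈ Λ} exp(2 h(W_1)) / exp(2 h(W_1 + W_2)), where for each p ∈ Λ, W_1 and W_2 denote independent random variables each with density p. -/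
open MeasureTheory ProbabilityTheory Real

/-- Discrete entropy power `Nd(X) = (1/(2πe)) exp (2 H(X))`. -/
noncomputable def dEntPow {Ω : Type*} [MeasurableSpace Ω] (μ : Measure Ω) (X : Ω → ℝ) : ℝ :=
  (1 / (2 * π * Real.exp 1)) * Real.exp (2 * dEnt μ X)

/-- The atoms (support points) of a real-valued discrete random variable. -/
def atoms {Ω : Type*} [MeasurableSpace Ω] (μ : Measure Ω) (X : Ω → ℝ) : Set ℝ :=
  {x : ℝ | μ (X ⁻¹' {x}) ≠ 0}

/-- Differential entropy `-∫ f log f` of a probability density function `f` on `ℝ`. -/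
noncomputable def entOfDensity (f : ℝ → ℝ) : ℝ :=
  -∫ x : ℝ, f x * Real.log (f x)

/-- The density of the sum `W₁ + W₂` of two independent random variables with common
density `f`: the convolution `(f ⋆ f) z = ∫ f x * f (z - x) dx`. -/
noncomputable def selfConv (f : ℝ → ℝ) : ℝ → ℝ :=
  fun z => ∫ x : ℝ, f x * f (z - x)

/-- `Λ α`: the set of probability density functions supported on `(-α/4, α/4)`
having finite differential entropy. -/
def Lam (α : ℝ) : Set (ℝ → ℝ) :=
  {f | Measurable f ∧ (∀ x, 0 ≤ f x) ∧
    (∀ x ∉ Set.Ioo (-(α / 4)) (α / 4), f x = 0) ∧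
    (∫ x : ℝ, f x) = 1 ∧ Integrable (fun x : ℝ => f x * Real.log (f x))}

/-- For `W₁`, `W₂` independent with common density `p`, the ratio
`exp (2 h(W₁)) / exp (2 h(W₁ + W₂))`; the sum `W₁ + W₂` has density `p ⋆ p`. -/
noncomputable def entRatio (p : ℝ → ℝ) : ℝ :=
  Real.exp (2 * entOfDensity p) / Real.exp (2 * entOfDensity (selfConv p))

open Filter Topology Set in
/-- The cumulative distribution function of an atomless probability measure is continuous. -/
theorem continuous_cdf (ν : Measure ℝ) [IsProbabilityMeasure ν] (hν : ∀ x, ν {x} = 0) :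
    Continuous (cdf ν) := by
  refine continuous_iff_continuousAt.2 fun x => ?_
  rw [(monotone_cdf ν).continuousAt_iff_leftLim_eq_rightLim, (cdf ν).rightLim_eq]
  have h := (cdf ν).measure_singleton x
  rw [measure_cdf, hν, eq_comm, ENNReal.ofReal_eq_zero] at h
  exact le_antisymm ((monotone_cdf ν).leftLim_le le_rfl) (by linarith)

theorem strictMono_cdf (γ : Measure ℝ) [IsProbabilityMeasure γ] [γ.IsOpenPosMeasure] :
    StrictMono (cdf γ) := by
  intro a b hab
  have h : 0 < γ (Set.Ioc a b) :=
    lt_of_lt_of_le (isOpen_Ioo.measure_pos γ (Set.nonempty_Ioo.2 hab))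
      (measure_mono Set.Ioo_subset_Ioc_self)
  rw [← measure_cdf γ, StieltjesFunction.measure_Ioc, ENNReal.ofReal_pos] at h
  linarith

open Filter Topology Set in
/-- Monotone transport between two atomless probability measures on the line, the first of which
has full support. -/
theorem exists_monotone_transport (γ ν : Measure ℝ) [IsProbabilityMeasure γ]
    [IsProbabilityMeasure ν] [γ.IsOpenPosMeasure] (hγ : ∀ x, γ {x} = 0) (hν : ∀ x, ν {x} = 0) :
    ∃ T : ℝ → ℝ, Monotone T ∧ γ.map T = ν ∧ ∀ x, cdf ν (T x) = cdf γ x := by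
  have hcγ := continuous_cdf γ hγ
  have hcν := continuous_cdf ν hν
  have hsγ := strictMono_cdf γ
  have hpos : ∀ x, 0 < cdf γ x := fun x =>
    (cdf_nonneg γ (x - 1)).trans_lt (hsγ (by linarith))
  have hlt : ∀ x, cdf γ x < 1 := fun x =>
    (hsγ (by linarith : x < x + 1)).trans_le (cdf_le_one γ _)
  set S : ℝ → Set ℝ := fun x => {t | cdf γ x ≤ cdf ν t} with hS
  have hne : ∀ x, (S x).Nonempty := fun x =>
    (((tendsto_cdf_atTop ν).eventually (lt_mem_nhds (hlt x))).exists).imp fun _ h => le_of_lt h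
  have hbdd : ∀ x, BddBelow (S x) := fun x => by
    obtain ⟨b, hb⟩ := ((tendsto_cdf_atBot ν).eventually (gt_mem_nhds (hpos x))).exists
    refine ⟨b, fun t ht => ?_⟩
    by_contra! h
    exact absurd ((ht.trans (monotone_cdf ν h.le)).trans_lt hb) (lt_irrefl _)
  have hclosed : ∀ x, IsClosed (S x) := fun x => isClosed_le continuous_const hcν
  have hmem : ∀ x, sInf (S x) ∈ S x := fun x => (hclosed x).csInf_mem (hne x) (hbdd x)
  have hgal : ∀ x t, sInf (S x) ≤ t ↔ cdf γ x ≤ cdf ν t := fun x t =>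
    ⟨fun h => (hmem x).trans (monotone_cdf ν h), fun h => csInf_le (hbdd x) h⟩
  have hmono : Monotone fun x => sInf (S x) := fun x y hxy =>
    (hgal x _).2 ((monotone_cdf γ hxy).trans (hmem y))
  refine ⟨fun x => sInf (S x), hmono, ?_, fun x => le_antisymm ?_ (hmem x)⟩
  · have : IsProbabilityMeasure (γ.map fun x => sInf (S x)) :=
      Measure.isProbabilityMeasure_map hmono.measurable.aemeasurable
    refine Measure.ext_of_Iic _ _ fun t => ?_
    rw [Measure.map_apply hmono.measurable measurableSet_Iic, ← ofReal_cdf ν t]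
    have hpre : (fun x => sInf (S x)) ⁻¹' Iic t = {x | cdf γ x ≤ cdf ν t} := by
      ext x; exact hgal x t
    rw [hpre]
    rcases (cdf_nonneg ν t).eq_or_lt with h0 | h0
    · have : {x | cdf γ x ≤ cdf ν t} = ∅ := by
        ext x; simpa [← h0] using hpos x
      rw [this, ← h0]; simp
    rcases (cdf_le_one ν t).eq_or_lt with h1 | h1
    · have : {x | cdf γ x ≤ cdf ν t} = univ := by
        ext x; simpa [h1] using (hlt x).le
      rw [this, h1]; simp
    · obtain ⟨a, ha⟩ := ((tendsto_cdf_atBot γ).eventually (gt_mem_nhds h0)).exists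
      obtain ⟨b, hb⟩ := ((tendsto_cdf_atTop γ).eventually (lt_mem_nhds h1)).exists
      obtain ⟨x₀, hx₀⟩ := mem_range_of_exists_le_of_exists_ge hcγ ⟨a, ha.le⟩ ⟨b, hb.le⟩
      have : {x | cdf γ x ≤ cdf ν t} = Iic x₀ := by
        ext x; simp [← hx₀, hsγ.le_iff_le]
      rw [this, ← hx₀, ofReal_cdf]
  · refine ContinuousWithinAt.closure_le (s := Iio (sInf (S x))) (f := cdf ν)
      (g := fun _ => cdf γ x) ?_ hcν.continuousWithinAt continuousWithinAt_const fun t ht => ?_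
    · rw [closure_Iio]; exact le_refl (sInf (S x))
    · by_contra! h
      exact absurd (csInf_le (hbdd x) (show t ∈ S x from h.le)) (not_le.2 ht)

/-- The Monge–Ampère (change of variables) equation for a transport map intertwining the
cumulative distribution functions. -/
theorem ae_density_mul_deriv_eq {φ f T : ℝ → ℝ} (hφm : Measurable φ) (hφ0 : ∀ x, 0 < φ x)
    (hfm : Measurable f) (hf0 : ∀ x, 0 ≤ f x) {γ ν : Measure ℝ} [IsProbabilityMeasure γ]
    [IsProbabilityMeasure ν] (hγ : γ = volume.withDensity fun x => ENNReal.ofReal (φ x))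
    (hν : ν = volume.withDensity fun x => ENNReal.ofReal (f x)) (hT : Monotone T)
    (hmap : γ.map T = ν) (hcdf : ∀ x, cdf ν (T x) = cdf γ x) :
    ∀ᵐ x ∂γ, DifferentiableAt ℝ T x ∧ 0 < deriv T x ∧ 0 < f (T x) ∧
      f (T x) * deriv T x = φ x := by
  have key : ∀ (ρ : Measure ℝ) [IsProbabilityMeasure ρ] (k : ℝ → ℝ), Measurable k →
      (∀ x, 0 ≤ k x) → ρ = volume.withDensity (fun x => ENNReal.ofReal (k x)) →
      ∀ᵐ x ∂volume, HasDerivAt (cdf ρ) (k x) x := by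
    intro ρ _ k hk hk0 hρ
    have h1 := (cdf ρ).ae_hasDerivAt
    rw [measure_cdf] at h1
    have h2 : ρ.rnDeriv volume =ᵐ[volume] fun x => ENNReal.ofReal (k x) := by
      conv_lhs => rw [hρ]
      exact Measure.rnDeriv_withDensity _ hk.ennreal_ofReal
    filter_upwards [h1, h2] with x hx1 hx2
    rwa [hx2, ENNReal.toReal_ofReal (hk0 x)] at hx1
  have hγv : γ ≪ volume := hγ ▸ withDensity_absolutelyContinuous _ _
  have hνv : ν ≪ volume := hν ▸ withDensity_absolutelyContinuous _ _
  have h1 := hγv.ae_le (key γ φ hφm (fun x => (hφ0 x).le) hγ)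
  have h2 : ∀ᵐ x ∂γ, HasDerivAt (cdf ν) (f (T x)) (T x) := by
    have := hνv.ae_le (key ν f hfm hf0 hν)
    rw [← hmap] at this
    have := ae_of_ae_map hT.measurable.aemeasurable this
    rwa [hmap] at this
  have h3 := hγv.ae_le hT.ae_differentiableAt
  filter_upwards [h1, h2, h3] with x hx1 hx2 hx3
  have h4 := hx2.comp x hx3.hasDerivAt
  have h5 : (cdf ν) ∘ T = cdf γ := funext hcdf
  rw [h5] at h4
  have h6 := h4.unique hx1
  have h7 : 0 < f (T x) * deriv T x := h6 ▸ hφ0 x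
  have hf : 0 < f (T x) := (hf0 _).lt_of_ne fun h => by simp [← h] at h7
  exact ⟨hx3, pos_of_mul_pos_right h7 hf.le, hf, h6⟩

theorem lintegral_deriv_mul_comp_le_of_monotone {Θ : ℝ → ℝ} (hΘ : Monotone Θ)
    (h : ℝ → ENNReal) :
    ∫⁻ u, ENNReal.ofReal (deriv Θ u) * h (Θ u) ≤ ∫⁻ z, h z := by
  set s : Set ℝ := {u | DifferentiableAt ℝ Θ u}
  have hs : MeasurableSet s := measurableSet_of_differentiableAt ℝ Θ
  have hs' : s =ᵐ[volume] Set.univ := Filter.eventuallyEq_univ.2 hΘ.ae_differentiableAt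
  rw [← setLIntegral_univ, ← setLIntegral_congr hs',
    ← lintegral_image_eq_lintegral_deriv_mul_of_monotoneOn hs
      (fun x hx => hx.hasDerivAt.hasDerivWithinAt) (hΘ.monotoneOn s) h]
  exact setLIntegral_le_lintegral _ _

theorem gaussian_prod_map_rotation :
    ((gaussianReal 0 1).prod (gaussianReal 0 1)).map
      (fun q : ℝ × ℝ => (√2 / 2 * q.1 - √2 / 2 * q.2, √2 / 2 * q.1 + √2 / 2 * q.2)) =
    (gaussianReal 0 1).prod (gaussianReal 0 1) := by
  have h := IsGaussian.map_rotation_eq_self (μ := gaussianReal 0 1)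
    (by simp) (-(π / 4))
  convert h using 2
  ext q <;> simp [ContinuousLinearMap.rotation_apply, sub_eq_add_neg]

/-- The conditional density obtained by rotating a pair of Gaussians and pushing the first
coordinate forward has total mass at most that of `h`. -/
theorem lintegral_gaussian_prod_transport_le {T : ℝ → ℝ} (hT : Monotone T) {h : ℝ → ENNReal}
    (hh : Measurable h) :
    ∫⁻ p : ℝ × ℝ, ENNReal.ofReal (√2 / 2 * (deriv T p.1 + deriv T p.2)) * h (T p.1 + T p.2) /
        ENNReal.ofReal (gaussianPDFReal 0 1 (√2 / 2 * (p.1 + p.2)))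
        ∂(gaussianReal 0 1).prod (gaussianReal 0 1) ≤ ∫⁻ z, h z := by
  set γ := gaussianReal 0 1 with hγ
  have hTm := hT.measurable
  have hdm : Measurable (deriv T) := measurable_deriv T
  have hφm := measurable_gaussianPDFReal 0 1
  have hRm : Measurable (fun q : ℝ × ℝ =>
      (√2 / 2 * q.1 - √2 / 2 * q.2, √2 / 2 * q.1 + √2 / 2 * q.2)) := by fun_prop
  have hγv : γ ≪ volume := gaussianReal_absolutelyContinuous 0 one_ne_zero
  have hdiff : ∀ᵐ p ∂γ.prod γ, DifferentiableAt ℝ T p.1 ∧ DifferentiableAt ℝ T p.2 := by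
    have h0 : ∀ᵐ x ∂γ, DifferentiableAt ℝ T x := hγv.ae_le hT.ae_differentiableAt
    exact (Measure.quasiMeasurePreserving_fst.ae h0).and (Measure.quasiMeasurePreserving_snd.ae h0)
  rw [← gaussian_prod_map_rotation] at hdiff
  have hdiff := ae_of_ae_map hRm.aemeasurable hdiff
  rw [← Measure.prod_swap] at hdiff
  have hdiff := Measure.ae_ae_of_ae_prod (ae_of_ae_map measurable_swap.aemeasurable hdiff)
  rw [← gaussian_prod_map_rotation, lintegral_map (by fun_prop) hRm, lintegral_prod_symm _
    (by fun_prop)]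
  calc _ ≤ ∫⁻ _ : ℝ, (∫⁻ z, h z) ∂γ := ?_
    _ = ∫⁻ z, h z := by simp [hγ]
  refine lintegral_mono_ae ?_
  filter_upwards [hdiff] with v hv
  set c := √2 / 2 with hc
  have hc2 : c * (c + c) = 1 := by
    have : √2 * √2 = 2 := Real.mul_self_sqrt (by norm_num)
    rw [hc]; linarith
  have hc0 : 0 ≤ c := by positivity
  refine le_trans (le_of_eq ?_) (lintegral_deriv_mul_comp_le_of_monotone
    (Θ := fun u => T (c * u - c * v) + T (c * u + c * v)) ?_ h)
  · have hv' := (gaussianReal_absolutelyContinuous' 0 (one_ne_zero (α := NNReal))).ae_le hv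
    rw [gaussianReal_of_var_ne_zero _ one_ne_zero, lintegral_withDensity_eq_lintegral_mul _
      (measurable_gaussianPDF 0 1) (by fun_prop)]
    refine lintegral_congr_ae ?_
    filter_upwards [hv'] with u hu
    have hd : HasDerivAt (fun u => T (c * u - c * v) + T (c * u + c * v))
        (deriv T (c * u - c * v) * c + deriv T (c * u + c * v) * c) u := by
      have e1 : HasDerivAt (fun u => c * u - c * v) c u := by
        simpa using ((hasDerivAt_id u).const_mul c).sub_const (c * v)
      have e2 : HasDerivAt (fun u => c * u + c * v) c u := by
        simpa using ((hasDerivAt_id u).const_mul c).add_const (c * v)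
      exact (hu.1.hasDerivAt.comp u e1).add (hu.2.hasDerivAt.comp u e2)
    have hu1 : c * ((c * u - c * v) + (c * u + c * v)) = u := by linear_combination u * hc2
    simp only [Pi.mul_apply]
    rw [hd.deriv, hu1, gaussianPDF, ENNReal.mul_div_cancel
      (by simpa using gaussianPDFReal_pos 0 1 u one_ne_zero) ENNReal.ofReal_ne_top]
    congr 2
    ring
  · intro a b hab
    exact add_le_add (hT (by gcongr)) (hT (by gcongr))

theorem half_log_add_log_le_log {a b : ℝ} (ha : 0 < a) (hb : 0 < b) :
    (Real.log 2 + Real.log a + Real.log b) / 2 ≤ Real.log (√2 / 2 * (a + b)) := by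
  have h2 : √2 ^ 2 = 2 := Real.sq_sqrt (by norm_num)
  have h : 2 * a * b ≤ (√2 / 2 * (a + b)) ^ 2 := by
    have : (√2 / 2 * (a + b)) ^ 2 = (a + b) ^ 2 / 2 := by
      rw [mul_pow, div_pow, h2]; ring
    rw [this]; nlinarith [sq_nonneg (a - b)]
  have h' := Real.log_le_log (by positivity) h
  rw [Real.log_mul (by positivity) hb.ne', Real.log_mul two_ne_zero ha.ne', Real.log_pow] at h'
  push_cast at h'
  linarith

theorem integrable_log_gaussianPDFReal :
    Integrable (fun x => Real.log (gaussianPDFReal 0 1 x)) (gaussianReal 0 1) := by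
  have h : (fun x => Real.log (gaussianPDFReal 0 1 x)) =
      fun x => Real.log (√(2 * π * (1 : NNReal)))⁻¹ + (-(1 / 2)) * x ^ 2 := by
    ext x
    rw [gaussianPDFReal_def]
    simp only
    rw [Real.log_mul (by positivity) (Real.exp_pos _).ne', Real.log_exp]
    congr 1
    simp
    ring
  rw [h]
  refine (integrable_const _).add (Integrable.const_mul ?_ _)
  exact (memLp_id_gaussianReal 2).integrable_sq

theorem integral_withDensity_ofReal {k : ℝ → ℝ} (hk : Measurable k) (hk0 : ∀ x, 0 ≤ k x)
    (F : ℝ → ℝ) :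
    ∫ x, F x ∂(volume.withDensity fun x => ENNReal.ofReal (k x)) = ∫ x, k x * F x := by
  rw [integral_withDensity_eq_integral_toReal_smul hk.ennreal_ofReal (by simp)]
  simp [ENNReal.toReal_ofReal (hk0 _)]

theorem integrable_withDensity_ofReal_iff {k : ℝ → ℝ} (hk : Measurable k) (hk0 : ∀ x, 0 ≤ k x)
    {F : ℝ → ℝ} :
    Integrable F (volume.withDensity fun x => ENNReal.ofReal (k x)) ↔
      Integrable fun x => k x * F x := by
  rw [integrable_withDensity_iff hk.ennreal_ofReal (by simp)]
  simp [ENNReal.toReal_ofReal (hk0 _), mul_comm]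

/-- The transport inequality behind the entropy power inequality for two independent copies of a
random variable with density `f`, tested against a density `g`. -/
theorem integral_log_add_le {f g : ℝ → ℝ} (hfm : Measurable f) (hf0 : ∀ x, 0 ≤ f x)
    (hgm : Measurable g) (hg0 : ∀ x, 0 ≤ g x) (hg1 : ∫⁻ x, ENNReal.ofReal (g x) ≤ 1)
    {ν : Measure ℝ} [IsProbabilityMeasure ν]
    (hν : ν = volume.withDensity fun x => ENNReal.ofReal (f x))
    (hfi : Integrable (fun x => Real.log (f x)) ν)
    (hpos : ∀ᵐ p ∂ν.prod ν, 0 < g (p.1 + p.2))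
    (hneg : Integrable (fun p : ℝ × ℝ => min (Real.log (g (p.1 + p.2))) 0) (ν.prod ν)) :
    Integrable (fun p : ℝ × ℝ => Real.log (g (p.1 + p.2))) (ν.prod ν) ∧
      ∫ p, Real.log (g (p.1 + p.2)) ∂ν.prod ν ≤
        ∫ x, Real.log (f x) ∂ν - Real.log 2 / 2 := by
  set γ := gaussianReal 0 1 with hγdef
  set φ := gaussianPDFReal 0 1 with hφdef
  have hφ0 : ∀ x, 0 < φ x := fun x => gaussianPDFReal_pos 0 1 x one_ne_zero
  have hφm : Measurable φ := measurable_gaussianPDFReal 0 1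
  have hγ : γ = volume.withDensity fun x => ENNReal.ofReal (φ x) :=
    gaussianReal_of_var_ne_zero 0 one_ne_zero
  have hvγ : volume ≪ γ := gaussianReal_absolutelyContinuous' 0 one_ne_zero
  have hγv : γ ≪ volume := gaussianReal_absolutelyContinuous 0 one_ne_zero
  have hνv : ν ≪ volume := hν ▸ withDensity_absolutelyContinuous _ _
  have : γ.IsOpenPosMeasure := hvγ.isOpenPosMeasure
  obtain ⟨T, hT, hmap, hcdf⟩ := exists_monotone_transport γ ν (fun x => hγv (by simp))
    (fun x => hνv (by simp))
  have hTm := hT.measurable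
  have hdm : Measurable (deriv T) := measurable_deriv T
  have hmap2 : (γ.prod γ).map (Prod.map T T) = ν.prod ν := by
    rw [← Measure.map_prod_map _ _ hTm hTm, hmap]
  have hTTm : Measurable (Prod.map T T) := hTm.prodMap hTm
  have hMA := ae_density_mul_deriv_eq hφm hφ0 hfm hf0 hγ hν hT hmap hcdf
  have hMA1 := Measure.quasiMeasurePreserving_fst (μ := γ) (ν := γ) |>.ae hMA
  have hMA2 := Measure.quasiMeasurePreserving_snd (μ := γ) (ν := γ) |>.ae hMA
  rw [← hmap2] at hpos
  have hpos' := ae_of_ae_map hTTm.aemeasurable hpos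
  set G : ℝ × ℝ → ℝ := fun p => Real.log (g (T p.1 + T p.2)) with hG
  set K : ℝ × ℝ → ℝ := fun p => √2 / 2 * (deriv T p.1 + deriv T p.2) * g (T p.1 + T p.2) /
    φ (√2 / 2 * (p.1 + p.2)) with hK
  set L : ℝ → ℝ := fun x => Real.log (φ x) with hL
  set M : ℝ → ℝ := fun x => Real.log (f (T x)) with hM
  have hd0 : ∀ x, 0 ≤ deriv T x := fun x => hT.deriv_nonneg
  have hK0 : ∀ p, 0 ≤ K p := fun p =>
    div_nonneg (mul_nonneg (mul_nonneg (by positivity) (add_nonneg (hd0 _) (hd0 _))) (hg0 _))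
      (hφ0 _).le
  have hKm : Measurable K := by fun_prop
  have hKl : ∫⁻ p, ENNReal.ofReal (K p) ∂γ.prod γ ≤ 1 := by
    refine le_trans (le_of_eq ?_) ((lintegral_gaussian_prod_transport_le hT
      hgm.ennreal_ofReal).trans hg1)
    refine lintegral_congr fun p => ?_
    rw [hK]
    simp only
    rw [ENNReal.ofReal_div_of_pos (hφ0 _), ENNReal.ofReal_mul
      (mul_nonneg (by positivity) (add_nonneg (hd0 _) (hd0 _)))]
  have hKi : Integrable K (γ.prod γ) :=
    ⟨hKm.aestronglyMeasurable, by
      rw [hasFiniteIntegral_iff_ofReal (Filter.Eventually.of_forall hK0)]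
      exact hKl.trans_lt ENNReal.one_lt_top⟩
  have hK1 : ∫ p, K p ∂γ.prod γ ≤ 1 := by
    rw [integral_eq_lintegral_of_nonneg_ae (Filter.Eventually.of_forall hK0)
      hKm.aestronglyMeasurable]
    exact ENNReal.toReal_le_of_le_ofReal zero_le_one (by simpa using hKl)
  have hLi : Integrable L γ := integrable_log_gaussianPDFReal
  have hMi : Integrable M γ := by
    rw [← hmap] at hfi
    exact hfi.comp_measurable hTm
  have hMint : ∫ x, M x ∂γ = ∫ x, Real.log (f x) ∂ν := by
    rw [← hmap, integral_map hTm.aemeasurable hfm.log.aestronglyMeasurable]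
  set U : ℝ × ℝ → ℝ := fun p => L (√2 / 2 * (p.1 + p.2)) with hU
  have hRm : Measurable (fun q : ℝ × ℝ =>
      (√2 / 2 * q.1 - √2 / 2 * q.2, √2 / 2 * q.1 + √2 / 2 * q.2)) := by fun_prop
  have hLm : Measurable L := by fun_prop
  have hUR : ∀ q : ℝ × ℝ, U (√2 / 2 * q.1 - √2 / 2 * q.2, √2 / 2 * q.1 + √2 / 2 * q.2) =
      L q.1 := fun q => by
    have h2 : √2 * √2 = 2 := Real.mul_self_sqrt (by norm_num)
    simp only [hU]
    congr 1
    linear_combination (q.1 / 2) * h2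
  have hUi : Integrable U (γ.prod γ) := by
    rw [hγdef, ← gaussian_prod_map_rotation, integrable_map_measure (by fun_prop)
      hRm.aemeasurable]
    exact (hLi.comp_fst γ).congr (Filter.Eventually.of_forall fun q => (hUR q).symm)
  have hUint : ∫ p, U p ∂γ.prod γ = ∫ x, L x ∂γ := by
    rw [hγdef, ← gaussian_prod_map_rotation, integral_map hRm.aemeasurable (by fun_prop)]
    rw [integral_congr_ae (Filter.Eventually.of_forall hUR), integral_fun_fst]
    simp
  set H : ℝ × ℝ → ℝ := fun p => K p - 1 + (U p - Real.log 2 / 2 -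
    ((L p.1 - M p.1) / 2 + (L p.2 - M p.2) / 2)) with hH
  have hLM : Integrable (fun x => (L x - M x) / 2) γ := (hLi.sub hMi).div_const 2
  have hHi : Integrable H (γ.prod γ) :=
    (hKi.sub (integrable_const _)).add ((hUi.sub (integrable_const _)).sub
      ((hLM.comp_fst γ).add (hLM.comp_snd γ)))
  have hGH : ∀ᵐ p ∂γ.prod γ, G p ≤ H p := by
    filter_upwards [hMA1, hMA2, hpos'] with p ⟨_, ha, hfa, hea⟩ ⟨_, hb, hfb, heb⟩ hgp
    replace hgp : 0 < g (T p.1 + T p.2) := hgp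
    have h1 := half_log_add_log_le_log ha hb
    have h2 : 0 < √2 / 2 * (deriv T p.1 + deriv T p.2) := by positivity
    have h3 : Real.log (K p) = Real.log (√2 / 2 * (deriv T p.1 + deriv T p.2)) + G p - U p := by
      simp only [hK]
      rw [Real.log_div (mul_pos h2 hgp).ne' (hφ0 _).ne', Real.log_mul h2.ne' hgp.ne']
    have h4 : Real.log (K p) ≤ K p - 1 :=
      Real.log_le_sub_one_of_pos (div_pos (mul_pos h2 hgp) (hφ0 _))
    have h5 : L p.1 = M p.1 + Real.log (deriv T p.1) := by
      simp only [hL, hM]; rw [← hea, Real.log_mul hfa.ne' ha.ne']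
    have h6 : L p.2 = M p.2 + Real.log (deriv T p.2) := by
      simp only [hL, hM]; rw [← heb, Real.log_mul hfb.ne' hb.ne']
    simp only [hH]
    linarith
  have hGm : Measurable G := by fun_prop
  have hneg' : Integrable (fun p => min (G p) 0) (γ.prod γ) := by
    rw [← hmap2] at hneg
    exact hneg.comp_measurable hTTm
  have hGi : Integrable G (γ.prod γ) :=
    integrable_of_le_of_le hGm.aestronglyMeasurable
      (Filter.Eventually.of_forall fun p => min_le_left _ _) hGH hneg' hHi
  have hgm' : Measurable fun p : ℝ × ℝ => Real.log (g (p.1 + p.2)) := by fun_prop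
  rw [← hmap2, integrable_map_measure hgm'.aestronglyMeasurable hTTm.aemeasurable,
    integral_map hTTm.aemeasurable hgm'.aestronglyMeasurable]
  refine ⟨hGi, (integral_mono_ae hGi hHi hGH).trans ?_⟩
  have e1 : ∫ p, H p ∂γ.prod γ = ∫ p, K p ∂γ.prod γ - 1 + (∫ p, U p ∂γ.prod γ - Real.log 2 / 2 -
      (∫ x, (L x - M x) / 2 ∂γ + ∫ x, (L x - M x) / 2 ∂γ)) := by
    have i1 : Integrable (fun p : ℝ × ℝ => (L p.1 - M p.1) / 2) (γ.prod γ) := hLM.comp_fst γ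
    have i2 : Integrable (fun p : ℝ × ℝ => (L p.2 - M p.2) / 2) (γ.prod γ) := hLM.comp_snd γ
    have i3 : Integrable (fun p => K p - 1) (γ.prod γ) := hKi.sub (integrable_const _)
    have i4 : Integrable (fun p => U p - Real.log 2 / 2) (γ.prod γ) :=
      hUi.sub (integrable_const _)
    have i5 : Integrable (fun p : ℝ × ℝ => (L p.1 - M p.1) / 2 + (L p.2 - M p.2) / 2)
      (γ.prod γ) := i1.add i2
    have i6 : Integrable (fun p : ℝ × ℝ => U p - Real.log 2 / 2 -
      ((L p.1 - M p.1) / 2 + (L p.2 - M p.2) / 2)) (γ.prod γ) := i4.sub i5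
    simp only [hH]
    rw [integral_add i3 i6, integral_sub hKi (integrable_const _), integral_sub i4 i5,
      integral_sub hUi (integrable_const _), integral_add i1 i2,
      integral_fun_fst (fun x => (L x - M x) / 2), integral_fun_snd (fun x => (L x - M x) / 2)]
    simp
  have e2 : ∫ x, (L x - M x) / 2 ∂γ = (∫ x, L x ∂γ - ∫ x, M x ∂γ) / 2 := by
    rw [integral_div, integral_sub hLi hMi]
  rw [e1, e2, hUint, ← hMint]
  linarith

theorem measurable_selfConv {f : ℝ → ℝ} (hf : Measurable f) : Measurable (selfConv f) := by
  have h : Measurable (Function.uncurry fun z x : ℝ => f x * f (z - x)) := by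
    unfold Function.uncurry; fun_prop
  exact h.stronglyMeasurable.integral_prod_right.measurable

theorem conv_withDensity_selfConv {f : ℝ → ℝ} (hfm : Measurable f) (hf0 : ∀ x, 0 ≤ f x)
    {ν : Measure ℝ} [IsProbabilityMeasure ν]
    (hν : ν = volume.withDensity fun x => ENNReal.ofReal (f x)) :
    ν.conv ν = volume.withDensity fun z => ENNReal.ofReal (selfConv f z) := by
  have hk : Measurable fun x => ENNReal.ofReal (f x) := hfm.ennreal_ofReal
  set k : ℝ → ENNReal := lconvolution (fun x => ENNReal.ofReal (f x))
    (fun x => ENNReal.ofReal (f x)) volume with hkdef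
  have h1 : ν.conv ν = volume.withDensity k := by
    rw [hν]; exact conv_withDensity_eq_lconvolution hk hk
  have hkm : Measurable k := measurable_lconvolution volume hk hk
  have h2 : ∫⁻ z, k z ≠ ⊤ := by
    rw [← setLIntegral_univ, ← withDensity_apply _ MeasurableSet.univ, ← h1]
    exact measure_ne_top _ _
  rw [h1]
  refine withDensity_congr_ae ?_
  filter_upwards [ae_lt_top hkm h2] with z hz
  have h3 : k z = ∫⁻ x, ENNReal.ofReal (f x * f (z - x)) := by
    rw [hkdef, lconvolution_def]
    refine lintegral_congr fun x => ?_
    rw [ENNReal.ofReal_mul (hf0 x), neg_add_eq_sub]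
  have h4 : ∀ᵐ x : ℝ, 0 ≤ f x * f (z - x) :=
    Filter.Eventually.of_forall fun x => mul_nonneg (hf0 _) (hf0 _)
  rw [h3] at hz ⊢
  refine (ofReal_integral_eq_lintegral_ofReal ⟨by fun_prop, ?_⟩ h4).symm
  rwa [hasFiniteIntegral_iff_ofReal h4]

theorem abs_mul_min_log_le_one {x : ℝ} (hx : 0 ≤ x) : |x * min (Real.log x) 0| ≤ 1 := by
  rcases hx.eq_or_lt with rfl | hx
  · simp
  rcases le_total x 1 with h | h
  · rw [min_eq_left (Real.log_nonpos hx.le h), mul_comm]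
    exact (Real.abs_log_mul_self_lt x hx h).le
  · rw [min_eq_right (Real.log_nonneg h)]; simp

theorem selfConv_eq_zero {f : ℝ → ℝ} {α z : ℝ}
    (hs : ∀ x ∉ Set.Ioo (-(α / 4)) (α / 4), f x = 0)
    (hz : z ∉ Set.Icc (-(α / 2)) (α / 2)) : selfConv f z = 0 := by
  refine integral_eq_zero_of_ae (Filter.Eventually.of_forall fun x => ?_)
  by_contra h
  obtain ⟨h1, h2⟩ := mul_ne_zero_iff.1 h
  have h1 := not_imp_comm.1 (hs x) h1
  have h2 := not_imp_comm.1 (hs (z - x)) h2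
  exact hz ⟨by linarith [h1.1, h2.1], by linarith [h1.2, h2.2]⟩

/-- The entropy power inequality for two independent copies of a compactly supported random
variable. -/
theorem entOfDensity_selfConv_ge {α : ℝ} {f : ℝ → ℝ} (hf : f ∈ Lam α) :
    entOfDensity f + Real.log 2 / 2 ≤ entOfDensity (selfConv f) := by
  obtain ⟨hfm, hf0, hs, hf1, hfl⟩ := hf
  set g := selfConv f with hg
  set ν : Measure ℝ := volume.withDensity fun x => ENNReal.ofReal (f x) with hν
  have hfi : Integrable f := by
    by_contra h
    rw [integral_undef h] at hf1
    exact zero_ne_one hf1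
  have : IsProbabilityMeasure ν := ⟨by
    rw [hν, withDensity_apply _ MeasurableSet.univ, setLIntegral_univ,
      ← ofReal_integral_eq_lintegral_ofReal hfi (Filter.Eventually.of_forall hf0), hf1,
      ENNReal.ofReal_one]⟩
  have hgm : Measurable g := measurable_selfConv hfm
  have hg0 : ∀ z, 0 ≤ g z := fun z => integral_nonneg fun x => mul_nonneg (hf0 _) (hf0 _)
  have hconv := conv_withDensity_selfConv hfm hf0 hν
  have hadd : Measurable fun p : ℝ × ℝ => p.1 + p.2 := measurable_fst.add measurable_snd
  have hmap : (ν.prod ν).map (fun p : ℝ × ℝ => p.1 + p.2) =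
      volume.withDensity fun z => ENNReal.ofReal (g z) := hconv
  have hg1 : ∫⁻ z, ENNReal.ofReal (g z) ≤ 1 := by
    rw [← setLIntegral_univ, ← withDensity_apply _ MeasurableSet.univ, ← hconv]
    exact prob_le_one
  have hpos : ∀ᵐ p ∂ν.prod ν, 0 < g (p.1 + p.2) := by
    refine ae_of_ae_map (p := fun z => 0 < g z) hadd.aemeasurable ?_
    rw [hmap, ae_withDensity_iff hgm.ennreal_ofReal]
    exact Filter.Eventually.of_forall fun z hz => by simpa using hz
  have hneg : Integrable (fun p : ℝ × ℝ => min (Real.log (g (p.1 + p.2))) 0) (ν.prod ν) := by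
    refine Integrable.comp_measurable (g := fun z => min (Real.log (g z)) 0) ?_ hadd
    rw [hmap, integrable_withDensity_ofReal_iff hgm hg0]
    have hi : Integrable ((Set.Icc (-(α / 2)) (α / 2)).indicator fun _ => (1 : ℝ)) :=
      (integrable_indicator_iff measurableSet_Icc).2 (integrableOn_const (by simp))
    refine hi.mono' (by fun_prop) (Filter.Eventually.of_forall fun z => ?_)
    by_cases hz : z ∈ Set.Icc (-(α / 2)) (α / 2)
    · rw [Set.indicator_of_mem hz]
      exact abs_mul_min_log_le_one (hg0 z)
    · rw [Set.indicator_of_notMem hz, hg, selfConv_eq_zero hs hz]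
      simp
  have key := (integral_log_add_le hfm hf0 hgm hg0 hg1 hν
    ((integrable_withDensity_ofReal_iff hfm hf0).2 hfl) hpos hneg).2
  rw [hν, integral_withDensity_ofReal hfm hf0, ← hν,
    ← integral_map (f := fun z => Real.log (g z)) hadd.aemeasurable
      hgm.log.aestronglyMeasurable, hmap, integral_withDensity_ofReal hgm hg0] at key
  unfold entOfDensity
  linarith

theorem entRatio_le_half {α : ℝ} {f : ℝ → ℝ} (hf : f ∈ Lam α) : entRatio f ≤ 1 / 2 := by
  have h := entOfDensity_selfConv_ge hf
  rw [entRatio, ← Real.exp_sub]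
  calc _ ≤ Real.exp (-Real.log 2) := Real.exp_le_exp.2 (by linarith)
    _ = 1 / 2 := by rw [Real.exp_neg, Real.exp_log two_pos, one_div]

section Discrete

variable {Ω : Type*} [MeasurableSpace Ω] {μ : Measure Ω}

theorem dEnt_eq_tsum_negMulLog (X : Ω → ℝ) :
    dEnt μ X = ∑' x : ℝ, negMulLog (μ.real (X ⁻¹' {x})) := by
  simp [dEnt, negMulLog, tsum_neg, Measure.real]

variable [IsProbabilityMeasure μ] {X Y : Ω → ℝ}

theorem measureReal_preimage_singleton_eq_zero {s : Finset ℝ} (hX : Measurable X)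
    (hs : μ (X ⁻¹' ↑s) = 1) {x : ℝ} (hx : x ∉ s) : μ.real (X ⁻¹' {x}) = 0 := by
  have h : μ (X ⁻¹' ↑s)ᶜ = 0 := (prob_compl_eq_zero_iff (hX s.measurableSet)).2 hs
  rw [measureReal_eq_zero_iff]
  refine measure_mono_null (fun ω hω => ?_) h
  simp only [Set.mem_preimage, Set.mem_singleton_iff] at hω
  simpa [hω] using hx

theorem sum_measureReal_fiber_eq_one {s : Finset ℝ} (hX : Measurable X)
    (hs : μ (X ⁻¹' ↑s) = 1) : ∑ x ∈ s, μ.real (X ⁻¹' {x}) = 1 := by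
  rw [MeasureTheory.sum_measureReal_preimage_singleton s fun x _ => hX (measurableSet_singleton x)]
  simp [Measure.real, hs]

theorem measureReal_add_preimage_singleton (hX : Measurable X) (hY : Measurable Y)
    (hindep : IndepFun X Y μ) {s : Finset ℝ} (hs : μ (Y ⁻¹' ↑s) = 1) (z : ℝ) :
    μ.real ((X + Y) ⁻¹' {z}) = ∑ y ∈ s, μ.real (Y ⁻¹' {y}) * μ.real (X ⁻¹' {z - y}) := by
  have hnull : μ (Y ⁻¹' ↑s)ᶜ = 0 := (prob_compl_eq_zero_iff (hY s.measurableSet)).2 hs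
  have h1 : ((X + Y) ⁻¹' {z} : Set Ω) =ᵐ[μ] ⋃ y ∈ s, (Y ⁻¹' {y} ∩ X ⁻¹' {z - y}) := by
    have hae : ∀ᵐ ω ∂μ, Y ω ∈ s := hnull
    filter_upwards [hae] with ω hω
    refine propext ?_
    change X ω + Y ω = z ↔ ω ∈ ⋃ y ∈ s, (Y ⁻¹' {y} ∩ X ⁻¹' {z - y})
    simp only [Set.mem_iUnion, Set.mem_inter_iff, Set.mem_preimage, Set.mem_singleton_iff]
    constructor
    · intro h
      exact ⟨Y ω, hω, rfl, by linarith⟩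
    · rintro ⟨y, -, hy, hx⟩
      linarith
  rw [measureReal_congr h1, measureReal_biUnion_finset]
  · refine Finset.sum_congr rfl fun y _ => ?_
    rw [Measure.real, hindep.symm.measure_inter_preimage_eq_mul _ _ (measurableSet_singleton _)
      (measurableSet_singleton _), ENNReal.toReal_mul]
    rfl
  · intro a _ b _ hab
    refine Set.disjoint_left.2 fun ω h1 h2 => hab ?_
    rw [← show Y ω = a from h1.1, ← show Y ω = b from h2.1]
  · intro y _
    exact (hY (measurableSet_singleton _)).inter (hX (measurableSet_singleton _))

/-- Adding an independent variable does not decrease entropy. -/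
theorem dEnt_le_dEnt_add (hX : Measurable X) (hY : Measurable Y) (hindep : IndepFun X Y μ)
    {sX sY : Finset ℝ} (hsX : μ (X ⁻¹' ↑sX) = 1) (hsY : μ (Y ⁻¹' ↑sY) = 1) :
    dEnt μ X ≤ dEnt μ (X + Y) := by
  have hZ := measureReal_add_preimage_singleton hX hY hindep hsY
  have hw := sum_measureReal_fiber_eq_one hY hsY
  have hXs : Summable fun x => negMulLog (μ.real (X ⁻¹' {x})) :=
    summable_of_ne_finset_zero (s := sX) fun x hx => by
      rw [measureReal_preimage_singleton_eq_zero hX hsX hx, negMulLog_zero]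
  have hXs' : ∀ y, Summable fun z => negMulLog (μ.real (X ⁻¹' {z - y})) := fun y =>
    (Equiv.subRight y).summable_iff (f := fun x => negMulLog (μ.real (X ⁻¹' {x}))) |>.2 hXs
  have hZs : Summable fun z => negMulLog (μ.real ((X + Y) ⁻¹' {z})) := by
    refine summable_of_ne_finset_zero
      (s := (sX ×ˢ sY).image fun p => p.1 + p.2) fun z hz => ?_
    rw [hZ, Finset.sum_eq_zero, negMulLog_zero]
    intro y hy
    rw [measureReal_preimage_singleton_eq_zero hX hsX, mul_zero]
    exact fun hx => hz (Finset.mem_image.2 ⟨(z - y, y), Finset.mem_product.2 ⟨hx, hy⟩, by simp⟩)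
  rw [dEnt_eq_tsum_negMulLog, dEnt_eq_tsum_negMulLog]
  calc ∑' x, negMulLog (μ.real (X ⁻¹' {x}))
      = ∑ y ∈ sY, μ.real (Y ⁻¹' {y}) * ∑' z, negMulLog (μ.real (X ⁻¹' {z - y})) := by
        have h : ∀ y, ∑' z, negMulLog (μ.real (X ⁻¹' {z - y})) =
            ∑' x, negMulLog (μ.real (X ⁻¹' {x})) := fun y =>
          (Equiv.subRight y).tsum_eq fun x => negMulLog (μ.real (X ⁻¹' {x}))
        simp only [h]
        rw [← Finset.sum_mul, hw, one_mul]
    _ = ∑' z, ∑ y ∈ sY, μ.real (Y ⁻¹' {y}) * negMulLog (μ.real (X ⁻¹' {z - y})) := by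
        rw [Summable.tsum_finsetSum fun y _ => (hXs' y).mul_left _]
        simp only [tsum_mul_left]
    _ ≤ ∑' z, negMulLog (μ.real ((X + Y) ⁻¹' {z})) := by
        refine Summable.tsum_le_tsum (fun z => ?_)
          (summable_sum fun y _ => (hXs' y).mul_left _) hZs
        rw [hZ]
        exact concaveOn_negMulLog.le_map_sum (fun _ _ => measureReal_nonneg) hw
          fun _ _ => measureReal_nonneg

end Discrete

/-- Let `X`, `Y` be independent discrete random variables with finite support and let
`α_z` be the minimum spacing of `Z = X + Y`.  Then
`Nd(X+Y) / (Nd(X) + Nd(Y)) ≥ sup_{p ∈ Λ} exp (2 h(W₁)) / exp (2 h(W₁ + W₂))`,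
where for each `p ∈ Λ` the random variables `W₁`, `W₂` are independent with density `p`. -/
theorem entropyPower_ratio_ge_sup
    {Ω : Type*} [MeasurableSpace Ω] (μ : Measure Ω) [IsProbabilityMeasure μ]
    (X Y : Ω → ℝ) (hX : Measurable X) (hY : Measurable Y)
    (hindep : IndepFun X Y μ)
    (sX sY : Finset ℝ) (hsX : μ (X ⁻¹' ↑sX) = 1) (hsY : μ (Y ⁻¹' ↑sY) = 1) :
    dEntPow μ (X + Y) / (dEntPow μ X + dEntPow μ Y) ≥
      sSup (entRatio '' Lam (minSpacing (atoms μ (X + Y)))) := by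
  have hc : (0 : ℝ) < 1 / (2 * π * Real.exp 1) := by positivity
  have h1 : dEntPow μ X ≤ dEntPow μ (X + Y) := mul_le_mul_of_nonneg_left
    (Real.exp_le_exp.2 (by linarith [dEnt_le_dEnt_add hX hY hindep hsX hsY])) hc.le
  have h2 : dEntPow μ Y ≤ dEntPow μ (X + Y) := mul_le_mul_of_nonneg_left
    (Real.exp_le_exp.2 (by
      have := dEnt_le_dEnt_add hY hX hindep.symm hsY hsX
      rw [add_comm Y X] at this
      linarith)) hc.le
  have hX0 : 0 < dEntPow μ X := mul_pos hc (Real.exp_pos _)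
  have hY0 : 0 < dEntPow μ Y := mul_pos hc (Real.exp_pos _)
  have h3 : 1 / 2 ≤ dEntPow μ (X + Y) / (dEntPow μ X + dEntPow μ Y) := by
    rw [le_div_iff₀ (by positivity)]
    linarith
  refine (Real.sSup_le ?_ (by norm_num)).trans h3
  rintro _ ⟨f, hf, rfl⟩
  exact entRatio_le_half hf
end

section
/- Fix α > 0. For every ε > 0 there exist independent identically distributed absolutely continuous random variables W_1, W_2 taking values in (−α/4, α/4) with finite differential entropy such that exp(2 h(W_1)) / exp(2 h(W_1 + W_2)) ≥ 1/2 − ε. Consequently sup_{p ∈ Λ} exp(2 h(W_1)) / exp(2 h(W_1 + W_2)) ≥ 1/2, where Λ is the set of densities supported on (−α/4, α/4) with finite differential entropy. -/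
open MeasureTheory ProbabilityTheory Real

lemma mul_log_tangent_le {s t : ℝ} (hs : 0 < s) (ht : 0 ≤ t) :
    t * Real.log s + t - s ≤ t * Real.log t := by
  rcases ht.eq_or_lt with rfl | ht
  · simp [hs.le]
  · have h := Real.self_sub_one_le_mul_log (div_nonneg ht.le hs.le)
    rw [Real.log_div ht.ne' hs.ne'] at h
    have h' := mul_le_mul_of_nonneg_left h hs.le
    have e₁ : s * (t / s - 1) = t - s := by field_simp
    have e₂ : s * (t / s * (Real.log t - Real.log s)) = t * Real.log t - t * Real.log s := by
      field_simp
    linarith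

section Convolution

variable {f g : ℝ → ℝ}

lemma integrable_conv_mul (hf : Integrable f) (hg : Integrable g) :
    Integrable (fun z => ∫ x, f x * g (z - x)) :=
  hf.integrable_convolution (ContinuousLinearMap.mul ℝ ℝ) hg

lemma integral_conv_mul (hf : Integrable f) (hg : Integrable g) :
    ∫ z, ∫ x, f x * g (z - x) = (∫ x, f x) * ∫ x, g x :=
  integral_convolution (ContinuousLinearMap.mul ℝ ℝ) hf hg

lemma ae_integrable_conv_mul (hf : Integrable f) (hg : Integrable g) :
    ∀ᵐ z, Integrable (fun x => f x * g (z - x)) :=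
  hf.ae_convolution_exists (ContinuousLinearMap.mul ℝ ℝ) hg

end Convolution

lemma Lam.integrable {α : ℝ} {p : ℝ → ℝ} (hp : p ∈ Lam α) : Integrable p :=
  integrable_of_integral_eq_one hp.2.2.2.1

lemma Lam.integrable_pow_mul {α : ℝ} {p : ℝ → ℝ} (hp : p ∈ Lam α) (n : ℕ) :
    Integrable (fun x => x ^ n * p x) := by
  refine ((Lam.integrable hp).const_mul ((α / 4) ^ n)).mono'
    ((measurable_id.pow_const n).mul hp.1).aestronglyMeasurable (ae_of_all _ fun x => ?_)
  by_cases hx : x ∈ Set.Ioo (-(α / 4)) (α / 4)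
  · rw [norm_mul, norm_pow, Real.norm_of_nonneg (hp.2.1 x)]
    have : ‖x‖ ≤ α / 4 := by
      rw [Real.norm_eq_abs, abs_le]; exact ⟨hx.1.le, hx.2.le⟩
    have h0 := hp.2.1 x
    gcongr
  · simp [hp.2.2.1 x hx]

lemma selfConv_nonneg {p : ℝ → ℝ} (hp : ∀ x, 0 ≤ p x) (z : ℝ) : 0 ≤ selfConv p z :=
  integral_nonneg fun x => mul_nonneg (hp x) (hp _)

lemma Lam.selfConv_eq_zero {α : ℝ} {p : ℝ → ℝ} (hp : p ∈ Lam α) {z : ℝ}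
    (hz : z ∉ Set.Icc (-(α / 2)) (α / 2)) : selfConv p z = 0 := by
  refine integral_eq_zero_of_ae (ae_of_all _ fun x => ?_)
  by_cases hx : x ∈ Set.Ioo (-(α / 4)) (α / 4)
  · have : z - x ∉ Set.Ioo (-(α / 4)) (α / 4) := fun h =>
      hz ⟨by linarith [hx.1, h.1], by linarith [hx.2, h.2]⟩
    simp [hp.2.2.1 _ this]
  · simp [hp.2.2.1 x hx]

lemma Lam.integrable_selfConv {α : ℝ} {p : ℝ → ℝ} (hp : p ∈ Lam α) : Integrable (selfConv p) :=
  integrable_conv_mul (Lam.integrable hp) (Lam.integrable hp)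

lemma Lam.integral_selfConv {α : ℝ} {p : ℝ → ℝ} (hp : p ∈ Lam α) : ∫ z, selfConv p z = 1 := by
  have := integral_conv_mul (Lam.integrable hp) (Lam.integrable hp)
  rw [hp.2.2.2.1, one_mul] at this
  exact this

/-- Jensen's inequality for `t ↦ t log t` and the averaging operator `f ↦ p ⋆ f`. -/
lemma Lam.selfConv_mul_log_le {α : ℝ} {p : ℝ → ℝ} (hp : p ∈ Lam α) :
    ∀ᵐ z, selfConv p z * Real.log (selfConv p z) ≤
      ∫ x, p x * (p (z - x) * Real.log (p (z - x))) := by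
  have hi := Lam.integrable hp
  filter_upwards [ae_integrable_conv_mul hi hi, ae_integrable_conv_mul hi hp.2.2.2.2] with z h₁ h₂
  rcases (selfConv_nonneg hp.2.1 z).eq_or_lt with h0 | hpos
  · have h : (fun x => p x * p (z - x)) =ᵐ[volume] 0 :=
      (integral_eq_zero_iff_of_nonneg (fun x => mul_nonneg (hp.2.1 x) (hp.2.1 _)) h₁).1 h0.symm
    rw [← h0, zero_mul]
    refine le_of_eq (integral_eq_zero_of_ae ?_).symm
    filter_upwards [h] with x hx
    rw [← mul_assoc, hx]
    simp
  · set q := selfConv p z with hq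
    have hadd : Integrable fun x => (p x * p (z - x)) * Real.log q + p x * p (z - x) :=
      (h₁.mul_const _).add h₁
    have hlow : ∫ x, ((p x * p (z - x)) * Real.log q + p x * p (z - x) - p x * q) ≤
        ∫ x, p x * (p (z - x) * Real.log (p (z - x))) := by
      refine integral_mono (hadd.sub (hi.mul_const _)) h₂ fun x => ?_
      have := mul_le_mul_of_nonneg_left (mul_log_tangent_le hpos (hp.2.1 (z - x))) (hp.2.1 x)
      refine le_trans (le_of_eq ?_) this
      ring
    rw [integral_sub hadd (hi.mul_const _),
      integral_add (h₁.mul_const _) h₁, integral_mul_const, integral_mul_const,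
      hp.2.2.2.1, show ∫ x, p x * p (z - x) = q from rfl] at hlow
    linarith

lemma Lam.integrable_selfConv_mul_log {α : ℝ} {p : ℝ → ℝ} (hp : p ∈ Lam α) :
    Integrable (fun z => selfConv p z * Real.log (selfConv p z)) := by
  have hi := Lam.integrable hp
  have hind : Integrable ((Set.Icc (-(α / 2)) (α / 2)).indicator fun _ => (1 : ℝ)) :=
    (integrable_indicator_iff measurableSet_Icc).2 (integrable_const _)
  refine ((integrable_conv_mul hi hp.2.2.2.2).abs.add hind).mono'
    (Real.continuous_mul_log.comp_aestronglyMeasurable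
      (Lam.integrable_selfConv hp).aestronglyMeasurable) ?_
  filter_upwards [Lam.selfConv_mul_log_le hp] with z hz
  by_cases hzI : z ∈ Set.Icc (-(α / 2)) (α / 2)
  · have h := Real.self_sub_one_le_mul_log (selfConv_nonneg hp.2.1 z)
    have h' := selfConv_nonneg hp.2.1 z
    simp only [Pi.add_apply, Set.indicator_of_mem hzI]
    rw [Real.norm_eq_abs, abs_le]
    constructor
    · linarith [abs_nonneg (∫ x, p x * (p (z - x) * Real.log (p (z - x))))]
    · linarith [le_abs_self (∫ x, p x * (p (z - x) * Real.log (p (z - x))))]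
  · simp only [Pi.add_apply, Set.indicator_of_notMem hzI, Lam.selfConv_eq_zero hp hzI]
    simp

/-- Adding an independent copy does not decrease the differential entropy. -/
lemma Lam.entOfDensity_le_selfConv {α : ℝ} {p : ℝ → ℝ} (hp : p ∈ Lam α) :
    entOfDensity p ≤ entOfDensity (selfConv p) := by
  have hi := Lam.integrable hp
  have h := integral_mono_ae (Lam.integrable_selfConv_mul_log hp)
    (integrable_conv_mul hi hp.2.2.2.2) (Lam.selfConv_mul_log_le hp)
  rw [integral_conv_mul hi hp.2.2.2.2, hp.2.2.2.1, one_mul] at h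
  exact neg_le_neg h

lemma entRatio_eq_exp (p : ℝ → ℝ) :
    entRatio p = Real.exp (2 * (entOfDensity p - entOfDensity (selfConv p))) := by
  rw [entRatio, ← Real.exp_sub, mul_sub]

lemma bddAbove_entRatio (α : ℝ) : BddAbove (entRatio '' Lam α) := by
  refine ⟨1, ?_⟩
  rintro _ ⟨p, hp, rfl⟩
  rw [entRatio_eq_exp, Real.exp_le_one_iff]
  linarith [Lam.entOfDensity_le_selfConv hp]

lemma Lam.integral_sq_mul_selfConv {α : ℝ} {p : ℝ → ℝ} (hp : p ∈ Lam α)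
    (hmean : ∫ x, x * p x = 0) :
    Integrable (fun z => z ^ 2 * selfConv p z) ∧
      ∫ z, z ^ 2 * selfConv p z = 2 * ∫ x, x ^ 2 * p x := by
  have h0 := Lam.integrable hp
  have h1 : Integrable (fun x => x * p x) := by simpa using Lam.integrable_pow_mul hp 1
  have h2 := Lam.integrable_pow_mul hp 2
  have hae : (fun z => z ^ 2 * selfConv p z) =ᵐ[volume] fun z =>
      (∫ x, (x ^ 2 * p x) * p (z - x)) + 2 * (∫ x, (x * p x) * ((z - x) * p (z - x))) +
        ∫ x, p x * ((z - x) ^ 2 * p (z - x)) := by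
    filter_upwards [ae_integrable_conv_mul h2 h0, ae_integrable_conv_mul h1 h1,
      ae_integrable_conv_mul h0 h2] with z a b c
    have hadd : Integrable fun x =>
        (x ^ 2 * p x) * p (z - x) + 2 * ((x * p x) * ((z - x) * p (z - x))) := a.add (b.const_mul 2)
    rw [selfConv, ← integral_const_mul, ← integral_const_mul, ← integral_add a (b.const_mul 2),
      ← integral_add hadd c]
    congr 1
    ext x
    ring
  have i20 := integrable_conv_mul h2 h0
  have i11 := (integrable_conv_mul h1 h1).const_mul 2
  have i02 := integrable_conv_mul h0 h2
  have hadd : Integrable fun z => (∫ x, (x ^ 2 * p x) * p (z - x)) +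
      2 * (∫ x, (x * p x) * ((z - x) * p (z - x))) := i20.add i11
  refine ⟨(hadd.add i02).congr hae.symm, ?_⟩
  rw [integral_congr_ae hae, integral_add hadd i02, integral_add i20 i11,
    integral_const_mul, integral_conv_mul h2 h0, integral_conv_mul h1 h1, integral_conv_mul h0 h2,
    hmean, hp.2.2.2.1]
  ring

lemma log_gaussianPDFReal_zero {v : NNReal} (hv : v ≠ 0) (x : ℝ) :
    Real.log (gaussianPDFReal 0 v x) = -(Real.log (2 * π * v) / 2) - x ^ 2 / (2 * v) := by
  have hv' : (0 : ℝ) < v := by positivity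
  rw [gaussianPDFReal, Real.log_mul (by positivity) (Real.exp_ne_zero _), Real.log_exp,
    Real.log_inv, Real.log_sqrt (by positivity)]
  ring

/-- The Gaussian maximizes the entropy of `W₁ + W₂` given its variance. -/
lemma Lam.entOfDensity_selfConv_le {α : ℝ} {p : ℝ → ℝ} (hp : p ∈ Lam α)
    (hmean : ∫ x, x * p x = 0) {v : NNReal} (hv : v ≠ 0) :
    entOfDensity (selfConv p) ≤
      Real.log (2 * π * v) / 2 + Real.log 2 / 2 + (∫ x, x ^ 2 * p x) / (2 * v) := by
  obtain ⟨hi2, hs⟩ := Lam.integral_sq_mul_selfConv hp hmean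
  have hq := Lam.integrable_selfConv hp
  have hv2 : 2 * v ≠ 0 := by positivity
  have hv' : (0 : ℝ) < v := by positivity
  have hg := integrable_gaussianPDFReal 0 (2 * v)
  set c := Real.log (2 * π * (2 * v : NNReal)) / 2 with hc
  set d : ℝ := 1 / (2 * (2 * v : NNReal)) with hd
  have ilow : Integrable fun z => (1 - c) * selfConv p z - d * (z ^ 2 * selfConv p z) :=
    (hq.const_mul _).sub (hi2.const_mul _)
  have h : ∫ z, ((1 - c) * selfConv p z - d * (z ^ 2 * selfConv p z) -
      gaussianPDFReal 0 (2 * v) z) ≤ ∫ z, selfConv p z * Real.log (selfConv p z) := by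
    refine integral_mono (ilow.sub hg) (Lam.integrable_selfConv_mul_log hp) fun z => ?_
    have := mul_log_tangent_le (gaussianPDFReal_pos 0 (2 * v) z hv2) (selfConv_nonneg hp.2.1 z)
    rw [log_gaussianPDFReal_zero hv2] at this
    refine le_trans (le_of_eq ?_) this
    simp only [hd, hc]
    ring
  rw [integral_sub ilow hg, integral_sub (hq.const_mul _) (hi2.const_mul _), integral_const_mul,
    integral_const_mul, hs, Lam.integral_selfConv hp, integral_gaussianPDFReal_eq_one 0 hv2] at h
  have hlog : Real.log (2 * π * (2 * v : NNReal)) = Real.log (2 * π * v) + Real.log 2 := by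
    rw [← Real.log_mul (by positivity) (by positivity)]
    congr 1
    push_cast
    ring
  have hd' : d * (2 * ∫ x, x ^ 2 * p x) = (∫ x, x ^ 2 * p x) / (2 * v) := by
    simp only [hd]
    push_cast
    field_simp
  rw [entOfDensity]
  rw [hd'] at h
  rw [hlog] at hc
  linarith

/-- The Gaussian mass of `(-a, a)`. -/
noncomputable def gaussMass (v : NNReal) (a : ℝ) : ℝ :=
  ∫ x in Set.Ioo (-a) a, gaussianPDFReal 0 v x

/-- The density of a centered Gaussian of variance `v` conditioned on `(-a, a)`. -/
noncomputable def truncGauss (v : NNReal) (a : ℝ) : ℝ → ℝ :=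
  (Set.Ioo (-a) a).indicator fun x => (gaussMass v a)⁻¹ * gaussianPDFReal 0 v x

lemma one_sub_le_gaussMass {v : NNReal} (hv : v ≠ 0) {a : ℝ} (ha : 0 < a) :
    1 - v / a ^ 2 ≤ gaussMass v a := by
  have hcheb := meas_ge_le_variance_div_sq (memLp_id_gaussianReal (μ := 0) (v := v) 2) ha
  simp only [id, variance_id_gaussianReal, integral_id_gaussianReal, sub_zero] at hcheb
  have hset : (Set.Ioo (-a) a)ᶜ = {x : ℝ | a ≤ |x|} := by
    ext x
    simp only [Set.mem_compl_iff, Set.mem_Ioo, ← abs_lt, not_lt, Set.mem_ofPred_eq]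
  have h0 : 0 ≤ gaussMass v a := integral_nonneg fun x => gaussianPDFReal_nonneg _ _ _
  have hreal : (gaussianReal 0 v).real (Set.Ioo (-a) a) = gaussMass v a := by
    rw [measureReal_def, gaussianReal_apply_eq_integral 0 hv]
    exact ENNReal.toReal_ofReal h0
  have hcompl := probReal_compl_eq_one_sub (μ := gaussianReal 0 v)
    (measurableSet_Ioo (a := -a) (b := a))
  rw [hreal, hset] at hcompl
  have : (gaussianReal 0 v).real {x : ℝ | a ≤ |x|} ≤ v / a ^ 2 :=
    ENNReal.toReal_le_of_le_ofReal (by positivity) hcheb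
  linarith

section TruncGauss

variable {v : NNReal} {α : ℝ}

lemma truncGauss_mul_log (hv : v ≠ 0) (a : ℝ) (hZ : 0 < gaussMass v a) (x : ℝ) :
    truncGauss v a x * Real.log (truncGauss v a x) =
      -(Real.log (gaussMass v a) + Real.log (2 * π * v) / 2) * truncGauss v a x -
        1 / (2 * v) * (x ^ 2 * truncGauss v a x) := by
  by_cases hx : x ∈ Set.Ioo (-a) a
  · have hlog : Real.log (truncGauss v a x) = -Real.log (gaussMass v a) +
        (-(Real.log (2 * π * v) / 2) - x ^ 2 / (2 * v)) := by
      rw [truncGauss, Set.indicator_of_mem hx, Real.log_mul (inv_ne_zero hZ.ne')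
        (gaussianPDFReal_pos 0 v x hv).ne', Real.log_inv, log_gaussianPDFReal_zero hv]
    rw [hlog]
    ring
  · simp [truncGauss, Set.indicator_of_notMem hx]

lemma truncGauss_mem_Lam (hv : v ≠ 0) (hZ : 0 < gaussMass v (α / 4)) :
    truncGauss v (α / 4) ∈ Lam α := by
  have hmeas : Measurable (truncGauss v (α / 4)) :=
    ((measurable_gaussianPDFReal 0 v).const_mul _).indicator measurableSet_Ioo
  have hnn : ∀ x, 0 ≤ truncGauss v (α / 4) x := fun x =>
    Set.indicator_nonneg (fun y _ => mul_nonneg (inv_nonneg.2 hZ.le)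
      (gaussianPDFReal_nonneg _ _ _)) x
  have hsupp : ∀ x ∉ Set.Ioo (-(α / 4)) (α / 4), truncGauss v (α / 4) x = 0 := fun x hx =>
    Set.indicator_of_notMem hx _
  have hone : ∫ x, truncGauss v (α / 4) x = 1 := by
    rw [truncGauss, integral_indicator measurableSet_Ioo, integral_const_mul]
    exact inv_mul_cancel₀ hZ.ne'
  have hi := integrable_of_integral_eq_one hone
  refine ⟨hmeas, hnn, hsupp, hone, ?_⟩
  simp_rw [truncGauss_mul_log hv _ hZ]
  refine (hi.const_mul _).sub (Integrable.const_mul ?_ _)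
  refine (hi.const_mul ((α / 4) ^ 2)).mono'
    ((measurable_id.pow_const 2).mul hmeas).aestronglyMeasurable (ae_of_all _ fun x => ?_)
  by_cases hx : x ∈ Set.Ioo (-(α / 4)) (α / 4)
  · rw [norm_mul, norm_pow, Real.norm_of_nonneg (hnn x), Real.norm_eq_abs]
    have : |x| ≤ α / 4 := abs_le.2 ⟨hx.1.le, hx.2.le⟩
    have h0 := hnn x
    gcongr
  · simp [hsupp x hx]

lemma integral_id_mul_truncGauss (a : ℝ) : ∫ x, x * truncGauss v a x = 0 := by
  have heven : ∀ x, truncGauss v a (-x) = truncGauss v a x := by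
    intro x
    have hmem : -x ∈ Set.Ioo (-a) a ↔ x ∈ Set.Ioo (-a) a := by
      simp only [Set.mem_Ioo]
      constructor <;> rintro ⟨h₁, h₂⟩ <;> constructor <;> linarith
    by_cases hx : x ∈ Set.Ioo (-a) a
    · simp [truncGauss, Set.indicator_of_mem hx, Set.indicator_of_mem (hmem.2 hx), gaussianPDFReal]
    · simp [truncGauss, Set.indicator_of_notMem hx, Set.indicator_of_notMem (mt hmem.1 hx)]
  have h := integral_neg_eq_self (fun x => x * truncGauss v a x) volume
  simp only [heven, neg_mul, integral_neg] at h
  linarith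

lemma entOfDensity_truncGauss (hv : v ≠ 0) (hZ : 0 < gaussMass v (α / 4)) :
    entOfDensity (truncGauss v (α / 4)) = Real.log (gaussMass v (α / 4)) +
      Real.log (2 * π * v) / 2 + (∫ x, x ^ 2 * truncGauss v (α / 4) x) / (2 * v) := by
  have hp := truncGauss_mem_Lam hv hZ
  rw [entOfDensity]
  simp_rw [truncGauss_mul_log hv _ hZ]
  rw [integral_sub ((Lam.integrable hp).const_mul _) ((Lam.integrable_pow_mul hp 2).const_mul _),
    integral_const_mul, integral_const_mul, hp.2.2.2.1]
  ring

lemma sq_gaussMass_div_two_le_entRatio (hv : v ≠ 0) (hZ : 0 < gaussMass v (α / 4)) :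
    gaussMass v (α / 4) ^ 2 / 2 ≤ entRatio (truncGauss v (α / 4)) := by
  have h := Lam.entOfDensity_selfConv_le (truncGauss_mem_Lam hv hZ)
    (integral_id_mul_truncGauss (α / 4)) hv
  rw [entRatio_eq_exp, entOfDensity_truncGauss hv hZ]
  rw [← Real.log_le_iff_le_exp (by positivity), Real.log_div (by positivity) two_ne_zero,
    Real.log_pow]
  push_cast
  linarith

end TruncGauss

lemma exists_mem_Lam_entRatio_ge {α : ℝ} (hα : 0 < α) {ε : ℝ} (hε : 0 < ε) :
    ∃ p ∈ Lam α, 1 / 2 - ε ≤ entRatio p := by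
  wlog hε1 : ε < 1 generalizing ε
  · obtain ⟨p, hp, h⟩ := this (ε := 1 / 2) (by norm_num) (by norm_num)
    exact ⟨p, hp, by linarith⟩
  have ha : 0 < α / 4 := by positivity
  set v : NNReal := ⟨ε * (α / 4) ^ 2, by positivity⟩ with hvdef
  have hvpos : (0 : ℝ) < v := by
    change 0 < ε * (α / 4) ^ 2
    positivity
  have hv : v ≠ 0 := by
    rintro h
    simp [h] at hvpos
  have hZ := one_sub_le_gaussMass hv ha
  have hdiv : (v : ℝ) / (α / 4) ^ 2 = ε := by
    change ε * (α / 4) ^ 2 / (α / 4) ^ 2 = ε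
    field_simp
  rw [hdiv] at hZ
  have hZ0 : 0 < gaussMass v (α / 4) := by linarith
  refine ⟨_, truncGauss_mem_Lam hv hZ0, le_trans ?_ (sq_gaussMass_div_two_le_entRatio hv hZ0)⟩
  nlinarith [pow_le_pow_left₀ (by linarith) hZ 2, sq_nonneg ε]

lemma cEnt_eq_entOfDensity {Ω : Type*} [MeasurableSpace Ω] {μ : Measure Ω} {V : Ω → ℝ}
    {f : ℝ → ℝ} (h : (fun x => (pdf V μ volume x).toReal) =ᵐ[volume] f) :
    cEnt μ V = entOfDensity f := by
  rw [cEnt, entOfDensity]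
  congr 1
  refine integral_congr_ae ?_
  filter_upwards [h] with x hx
  rw [hx]

lemma toReal_pdf_add_ae_eq_selfConv {Ω : Type*} [MeasurableSpace Ω] {μ : Measure Ω}
    [IsFiniteMeasure μ] {X Y : Ω → ℝ} [HasPDF X μ volume] [HasPDF Y μ volume]
    (hXY : IndepFun X Y μ) {p : ℝ → ℝ} (hp : Measurable p) (hp0 : ∀ x, 0 ≤ p x)
    (hX : pdf X μ volume =ᵐ[volume] fun x => ENNReal.ofReal (p x))
    (hY : pdf Y μ volume =ᵐ[volume] fun x => ENNReal.ofReal (p x)) :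
    (fun x => (pdf (X + Y) μ volume x).toReal) =ᵐ[volume] selfConv p := by
  filter_upwards [hXY.pdf_add_eq_lconvolution_pdf (μ := volume)] with z hz
  rw [hz, lconvolution_def, selfConv, integral_eq_lintegral_of_nonneg_ae
    (ae_of_all _ fun x => mul_nonneg (hp0 x) (hp0 _)) (by fun_prop)]
  congr 1
  refine lintegral_congr_ae ?_
  filter_upwards [hX, (Measure.measurePreserving_sub_left volume z).quasiMeasurePreserving.ae hY]
    with x h₁ h₂
  rw [h₁, neg_add_eq_sub, h₂, ENNReal.ofReal_mul (hp0 x)]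

lemma exists_iid_of_mem_Lam {α : ℝ} (hα : 0 < α) {p : ℝ → ℝ} (hp : p ∈ Lam α) :
    ∃ (Ω : Type) (_ : MeasurableSpace Ω) (μ : Measure Ω) (_ : IsProbabilityMeasure μ)
      (W₁ W₂ : Ω → ℝ),
      Measurable W₁ ∧ Measurable W₂ ∧ IndepFun W₁ W₂ μ ∧
      Measure.map W₁ μ = Measure.map W₂ μ ∧ HasPDF W₁ μ volume ∧
      (∀ ω, W₁ ω ∈ Set.Ioo (-(α / 4)) (α / 4)) ∧
      (∀ ω, W₂ ω ∈ Set.Ioo (-(α / 4)) (α / 4)) ∧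
      Integrable (fun x : ℝ =>
        (pdf W₁ μ volume x).toReal * Real.log (pdf W₁ μ volume x).toReal) ∧
      Real.exp (2 * cEnt μ W₁) / Real.exp (2 * cEnt μ (W₁ + W₂)) = entRatio p := by
  set I := Set.Ioo (-(α / 4)) (α / 4) with hI
  set ν : Measure ℝ := volume.withDensity fun x => ENNReal.ofReal (p x) with hν
  have hpm : Measurable fun x => ENNReal.ofReal (p x) := hp.1.ennreal_ofReal
  have hprob : IsProbabilityMeasure ν := by
    refine ⟨?_⟩
    rw [hν, withDensity_apply _ MeasurableSet.univ, setLIntegral_univ,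
      ← ofReal_integral_eq_lintegral_ofReal (Lam.integrable hp) (ae_of_all _ hp.2.1),
      hp.2.2.2.1, ENNReal.ofReal_one]
  set φ : ℝ → ℝ := I.indicator id with hφ
  have hφm : Measurable φ := measurable_id.indicator measurableSet_Ioo
  have hφI : ∀ x, φ x ∈ I := by
    intro x
    by_cases hx : x ∈ I
    · simp [hφ, hx]
    · rw [hφ, Set.indicator_of_notMem hx, hI, Set.mem_Ioo]
      constructor <;> linarith
  have hφid : φ =ᵐ[ν] id := by
    rw [hν, Filter.EventuallyEq, ae_withDensity_iff hpm]
    refine ae_of_all _ fun x hx => ?_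
    have : x ∈ I := by
      by_contra h
      exact hx (by simp [hp.2.2.1 x h])
    simp [hφ, this]
  have hmapφ : ν.map φ = ν := by rw [Measure.map_congr hφid, Measure.map_id]
  have h₁m : Measurable fun ω : ℝ × ℝ => φ ω.1 := hφm.comp measurable_fst
  have h₂m : Measurable fun ω : ℝ × ℝ => φ ω.2 := hφm.comp measurable_snd
  have hmap₁ : (ν.prod ν).map (fun ω : ℝ × ℝ => φ ω.1) = ν := by
    rw [← Function.comp_def, ← Measure.map_map hφm measurable_fst, Measure.map_fst_prod]
    simpa using hmapφ
  have hmap₂ : (ν.prod ν).map (fun ω : ℝ × ℝ => φ ω.2) = ν := by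
    rw [← Function.comp_def, ← Measure.map_map hφm measurable_snd, Measure.map_snd_prod]
    simpa using hmapφ
  have hpdf₁ : HasPDF (fun ω : ℝ × ℝ => φ ω.1) (ν.prod ν) volume :=
    hasPDF_of_map_eq_withDensity h₁m.aemeasurable _ hpm.aemeasurable hmap₁
  have hpdf₂ : HasPDF (fun ω : ℝ × ℝ => φ ω.2) (ν.prod ν) volume :=
    hasPDF_of_map_eq_withDensity h₂m.aemeasurable _ hpm.aemeasurable hmap₂
  have hd₁ := (pdf.eq_of_map_eq_withDensity (μ := volume)
    (X := fun ω : ℝ × ℝ => φ ω.1) _ hpm.aemeasurable).1 hmap₁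
  have hd₂ := (pdf.eq_of_map_eq_withDensity (μ := volume)
    (X := fun ω : ℝ × ℝ => φ ω.2) _ hpm.aemeasurable).1 hmap₂
  have hind : IndepFun (fun ω : ℝ × ℝ => φ ω.1) (fun ω : ℝ × ℝ => φ ω.2) (ν.prod ν) :=
    indepFun_prod hφm hφm
  have hr₁ : (fun x => (pdf (fun ω : ℝ × ℝ => φ ω.1) (ν.prod ν) volume x).toReal)
      =ᵐ[volume] p := by
    filter_upwards [hd₁] with x hx
    rw [hx, ENNReal.toReal_ofReal (hp.2.1 x)]
  refine ⟨ℝ × ℝ, inferInstance, ν.prod ν, inferInstance, fun ω => φ ω.1, fun ω => φ ω.2, h₁m, h₂m,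
    hind, hmap₁.trans hmap₂.symm, hpdf₁, fun ω => hφI _, fun ω => hφI _, ?_, ?_⟩
  · refine hp.2.2.2.2.congr ?_
    filter_upwards [hr₁] with x hx
    rw [hx]
  · rw [cEnt_eq_entOfDensity hr₁, cEnt_eq_entOfDensity
      (toReal_pdf_add_ae_eq_selfConv hind hp.1 hp.2.1 hd₁ hd₂), entRatio]

/-- Fix `α > 0`.  For every `ε > 0` there exist i.i.d. absolutely continuous random
variables `W₁`, `W₂` taking values in `(-α/4, α/4)` with finite differential entropy
such that `exp (2 h(W₁)) / exp (2 h(W₁ + W₂)) ≥ 1/2 - ε`.  Consequently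
`sup_{p ∈ Λ} exp (2 h(W₁)) / exp (2 h(W₁ + W₂)) ≥ 1/2`. -/
theorem sup_entRatio_ge_half (α : ℝ) (hα : 0 < α) :
    (∀ ε > (0 : ℝ),
      ∃ (Ω : Type) (_ : MeasurableSpace Ω) (μ : Measure Ω) (_ : IsProbabilityMeasure μ)
        (W₁ W₂ : Ω → ℝ),
        Measurable W₁ ∧ Measurable W₂ ∧ IndepFun W₁ W₂ μ ∧
        Measure.map W₁ μ = Measure.map W₂ μ ∧ HasPDF W₁ μ volume ∧
        (∀ ω, W₁ ω ∈ Set.Ioo (-(α / 4)) (α / 4)) ∧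
        (∀ ω, W₂ ω ∈ Set.Ioo (-(α / 4)) (α / 4)) ∧
        Integrable (fun x : ℝ =>
          (pdf W₁ μ volume x).toReal * Real.log (pdf W₁ μ volume x).toReal) ∧
        Real.exp (2 * cEnt μ W₁) / Real.exp (2 * cEnt μ (W₁ + W₂)) ≥ 1 / 2 - ε) ∧
    sSup (entRatio '' Lam α) ≥ 1 / 2 := by
  refine ⟨fun ε hε => ?_, le_of_forall_sub_le fun ε hε => ?_⟩
  · obtain ⟨p, hp, h⟩ := exists_mem_Lam_entRatio_ge hα hε
    obtain ⟨Ω, mΩ, μ, hμ, W₁, W₂, h₁, h₂, h₃, h₄, h₅, h₆, h₇, h₈, h₉⟩ := exists_iid_of_mem_Lam hα hp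
    exact ⟨Ω, mΩ, μ, hμ, W₁, W₂, h₁, h₂, h₃, h₄, h₅, h₆, h₇, h₈, h₉ ▸ h⟩
  · obtain ⟨p, hp, h⟩ := exists_mem_Lam_entRatio_ge hα hε
    exact h.trans (le_csSup (bddAbove_entRatio α) ⟨p, hp, rfl⟩)
end

section
/- Fix α > 0. For σ > 0 let K(σ) = (∫_{−α/4}^{α/4} (1/(√(2π)σ)) exp(−x²/(2σ²)) dx)^{−1}, η(σ) = log(√(2π)σ) · ∫_{α/(4σ)}^{∞} (1/√(2π)) exp(−x²/2) dx, Φ(σ) = ∫_{α/(4σ)}^{∞} (x²/√(2π)) exp(−x²/2) dx, and define F(σ) = exp(log(2πe σ²)(K(σ) − 1)) · exp(−2 log K(σ) − 2K(σ)[2η(σ) + Φ(σ)]) / K(σ). Then F(σ) → 1 as σ → 0⁺. -/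
open MeasureTheory Real Filter Topology

/-- The normalizing constant of the Gaussian `N(0, σ²)` truncated to `(-α/4, α/4)`. -/
noncomputable def truncK (α σ : ℝ) : ℝ :=
  (∫ x in Set.Ioo (-(α / 4)) (α / 4),
    (1 / (Real.sqrt (2 * π) * σ)) * Real.exp (-x ^ 2 / (2 * σ ^ 2)))⁻¹

/-- `η(σ) = log(√(2π)σ) ∫_{α/(4σ)}^∞ (1/√(2π)) exp (-x²/2) dx`. -/
noncomputable def etaFun (α σ : ℝ) : ℝ :=
  Real.log (Real.sqrt (2 * π) * σ) *
    ∫ x in Set.Ioi (α / (4 * σ)), (1 / Real.sqrt (2 * π)) * Real.exp (-x ^ 2 / 2)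

/-- `Φ(σ) = ∫_{α/(4σ)}^∞ (x²/√(2π)) exp (-x²/2) dx`. -/
noncomputable def PhiFun (α σ : ℝ) : ℝ :=
  ∫ x in Set.Ioi (α / (4 * σ)), x ^ 2 / Real.sqrt (2 * π) * Real.exp (-x ^ 2 / 2)

/-- `F(σ) = exp (log(2πe σ²)(K(σ) - 1)) exp (-2 log K(σ) - 2 K(σ)[2η(σ) + Φ(σ)]) / K(σ)`. -/
noncomputable def Ffun (α σ : ℝ) : ℝ :=
  Real.exp (Real.log (2 * π * Real.exp 1 * σ ^ 2) * (truncK α σ - 1)) *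
    Real.exp (-2 * Real.log (truncK α σ)
      - 2 * truncK α σ * (2 * etaFun α σ + PhiFun α σ)) / truncK α σ

lemma integrable_gaussian_density :
    Integrable fun x : ℝ => 1 / √(2 * π) * exp (-x ^ 2 / 2) := by
  have h := (integrable_exp_neg_mul_sq (b := 1 / 2) (by norm_num)).const_mul (1 / √(2 * π))
  refine h.congr (Eventually.of_forall fun x => ?_)
  dsimp only
  ring_nf

lemma integrable_sq_mul_gaussian_density :
    Integrable fun x : ℝ => x ^ 2 / √(2 * π) * exp (-x ^ 2 / 2) := by
  have h := (integrable_rpow_mul_exp_neg_mul_sq (b := 1 / 2) (s := 2) (by norm_num)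
    (by norm_num)).const_mul (1 / √(2 * π))
  refine h.congr (Eventually.of_forall fun x => ?_)
  simp only [rpow_two]
  ring_nf

/-- The tail `P(Z > t)` of the standard Gaussian. -/
noncomputable def gaussianTail (t : ℝ) : ℝ :=
  ∫ x in Set.Ioi t, 1 / √(2 * π) * exp (-x ^ 2 / 2)

lemma gaussianTail_nonneg (t : ℝ) : 0 ≤ gaussianTail t :=
  integral_nonneg fun x => by positivity

lemma gaussianTail_zero : gaussianTail 0 = 1 / 2 := by
  have h := integral_gaussian_Ioi (1 / 2)
  have h2 : π / (1 / 2) = 2 * π := by ring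
  rw [h2] at h
  have hs : √(2 * π) ≠ 0 := by positivity
  unfold gaussianTail
  rw [integral_const_mul]
  have h3 : ∀ x : ℝ, -x ^ 2 / 2 = -(1 / 2) * x ^ 2 := fun x => by ring
  simp only [h3]
  rw [h]
  field_simp

/-- A Chebyshev-type bound on the Gaussian tail. -/
lemma sq_mul_gaussianTail_le {t : ℝ} (ht : 0 ≤ t) :
    t ^ 2 * gaussianTail t ≤ ∫ x in Set.Ioi t, x ^ 2 / √(2 * π) * exp (-x ^ 2 / 2) := by
  unfold gaussianTail
  rw [← integral_const_mul]
  refine setIntegral_mono_on (integrable_gaussian_density.const_mul _).integrableOn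
    integrable_sq_mul_gaussian_density.integrableOn measurableSet_Ioi fun x hx => ?_
  have hx' : t ^ 2 ≤ x ^ 2 := pow_le_pow_left₀ ht (le_of_lt hx) 2
  calc t ^ 2 * (1 / √(2 * π) * exp (-x ^ 2 / 2))
      ≤ x ^ 2 * (1 / √(2 * π) * exp (-x ^ 2 / 2)) := by gcongr
    _ = _ := by ring

lemma intervalIntegral_gaussian_density (t : ℝ) :
    ∫ x in (-t)..t, 1 / √(2 * π) * exp (-x ^ 2 / 2) = 1 - 2 * gaussianTail t := by
  have hint := integrable_gaussian_density
  have h1 : ∫ x in (0)..t, 1 / √(2 * π) * exp (-x ^ 2 / 2) = 1 / 2 - gaussianTail t := by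
    have := intervalIntegral.integral_Ioi_sub_Ioi' (μ := volume) (a := 0) (b := t)
      hint.integrableOn hint.integrableOn
    rw [← this, ← gaussianTail_zero]
    rfl
  have h2 : ∫ x in (-t)..0, 1 / √(2 * π) * exp (-x ^ 2 / 2) = 1 / 2 - gaussianTail t := by
    rw [← h1]
    have := intervalIntegral.integral_comp_neg (a := 0) (b := t)
      (fun x : ℝ => 1 / √(2 * π) * exp (-x ^ 2 / 2))
    simpa using this.symm
  rw [← intervalIntegral.integral_add_adjacent_intervals (b := 0)
    hint.intervalIntegrable hint.intervalIntegrable, h1, h2]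
  ring

lemma truncK_eq {α σ : ℝ} (hα : 0 < α) (hσ : 0 < σ) :
    truncK α σ = (1 - 2 * gaussianTail (α / (4 * σ)))⁻¹ := by
  unfold truncK
  rw [← integral_Ioc_eq_integral_Ioo, ← intervalIntegral.integral_of_le (by linarith),
    ← intervalIntegral_gaussian_density]
  have h := intervalIntegral.inv_mul_integral_comp_div (a := -(α / 4)) (b := α / 4)
    (f := fun x : ℝ => 1 / √(2 * π) * exp (-x ^ 2 / 2)) σ
  have e1 : -(α / 4) / σ = -(α / (4 * σ)) := by field_simp
  have e2 : α / 4 / σ = α / (4 * σ) := by field_simp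
  rw [e1, e2, ← intervalIntegral.integral_const_mul] at h
  rw [← h]
  congr 1
  refine intervalIntegral.integral_congr fun x _ => ?_
  have hs : √(2 * π) ≠ 0 := by positivity
  have e3 : -x ^ 2 / (2 * σ ^ 2) = -(x / σ) ^ 2 / 2 := by field_simp
  simp only [e3]
  field_simp

lemma tendsto_div_mul_nhdsGT_zero_atTop {α : ℝ} (hα : 0 < α) :
    Tendsto (fun σ : ℝ => α / (4 * σ)) (𝓝[>] 0) atTop := by
  have h := tendsto_inv_nhdsGT_zero (𝕜 := ℝ).const_mul_atTop (by positivity : 0 < α / 4)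
  refine h.congr fun σ => ?_
  rw [div_mul_eq_div_div, div_eq_mul_inv (α / 4)]

lemma tendsto_PhiFun {α : ℝ} (hα : 0 < α) : Tendsto (PhiFun α) (𝓝[>] 0) (𝓝 0) :=
  tendsto_integral_Ioi_zero (tendsto_div_mul_nhdsGT_zero_atTop hα)

lemma tendsto_gaussianTail {α : ℝ} (hα : 0 < α) :
    Tendsto (fun σ => gaussianTail (α / (4 * σ))) (𝓝[>] 0) (𝓝 0) :=
  tendsto_integral_Ioi_zero (tendsto_div_mul_nhdsGT_zero_atTop hα)

lemma tendsto_log_mul_gaussianTail {α : ℝ} (hα : 0 < α) :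
    Tendsto (fun σ => log σ * gaussianTail (α / (4 * σ))) (𝓝[>] 0) (𝓝 0) := by
  have hlog : Tendsto (fun σ : ℝ => |log σ * σ ^ 2|) (𝓝[>] 0) (𝓝 0) := by
    have h := (tendsto_log_mul_rpow_nhdsGT_zero (r := 2) (by norm_num)).abs
    simpa using h
  have h := (hlog.mul (tendsto_PhiFun hα)).const_mul (16 / α ^ 2)
  simp only [mul_zero] at h
  refine squeeze_zero_norm' ?_ h
  filter_upwards [self_mem_nhdsWithin] with σ hσ
  have hσ : 0 < σ := hσ
  have hb : (α / (4 * σ)) ^ 2 * gaussianTail (α / (4 * σ)) ≤ PhiFun α σ :=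
    sq_mul_gaussianTail_le (by positivity)
  rw [norm_mul, norm_eq_abs, norm_eq_abs, abs_of_nonneg (gaussianTail_nonneg _), abs_mul,
    abs_of_nonneg (sq_nonneg σ)]
  calc |log σ| * gaussianTail (α / (4 * σ))
      = 16 / α ^ 2 * (|log σ| * σ ^ 2 * ((α / (4 * σ)) ^ 2 * gaussianTail (α / (4 * σ)))) := by
        field_simp
        ring
    _ ≤ _ := by gcongr

/-- `F(σ) → 1` as `σ → 0⁺`. -/
theorem Ffun_tendsto_one (α : ℝ) (hα : 0 < α) :
    Tendsto (fun σ => Ffun α σ) (𝓝[>] 0) (𝓝 1) := by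
  have hQ := tendsto_gaussianTail hα
  have hLQ := tendsto_log_mul_gaussianTail hα
  have hpos : ∀ᶠ σ : ℝ in 𝓝[>] 0, 0 < σ := self_mem_nhdsWithin
  have hK : Tendsto (truncK α) (𝓝[>] 0) (𝓝 1) := by
    have h : Tendsto (fun σ => (1 - 2 * gaussianTail (α / (4 * σ)))⁻¹) (𝓝[>] 0)
        (𝓝 (1 - 2 * 0)⁻¹) := ((hQ.const_mul 2).const_sub 1).inv₀ (by norm_num)
    rw [mul_zero, sub_zero, inv_one] at h
    refine h.congr' ?_
    filter_upwards [hpos] with σ hσ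
    exact (truncK_eq hα hσ).symm
  have heta : Tendsto (etaFun α) (𝓝[>] 0) (𝓝 0) := by
    have h := (hQ.const_mul (log √(2 * π))).add hLQ
    simp only [mul_zero, add_zero] at h
    refine h.congr' ?_
    filter_upwards [hpos] with σ hσ
    rw [etaFun, log_mul (by positivity) hσ.ne', add_mul]
    rfl
  have hlogK : Tendsto (fun σ => log (2 * π * exp 1 * σ ^ 2) * (truncK α σ - 1))
      (𝓝[>] 0) (𝓝 0) := by
    have h := hK.mul (((hQ.const_mul (log (2 * π * exp 1))).add (hLQ.const_mul 2)).const_mul 2)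
    simp only [mul_zero, add_zero] at h
    refine h.congr' ?_
    filter_upwards [hpos, hQ.eventually_lt_const (by norm_num : (0 : ℝ) < 1 / 2)] with σ hσ hlt
    have hne : 1 - 2 * gaussianTail (α / (4 * σ)) ≠ 0 := by linarith
    rw [log_mul (y := σ ^ 2) (by positivity) (by positivity), log_pow, truncK_eq hα hσ]
    push_cast
    field_simp
    ring
  have hE : Tendsto (fun σ => -2 * log (truncK α σ)
      - 2 * truncK α σ * (2 * etaFun α σ + PhiFun α σ)) (𝓝[>] 0) (𝓝 0) := by
    have h := ((hK.log one_ne_zero).const_mul (-2)).sub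
      ((hK.const_mul 2).mul ((heta.const_mul 2).add (tendsto_PhiFun hα)))
    simpa using h
  have h := ((hlogK.rexp).mul (hE.rexp)).div hK one_ne_zero
  rw [exp_zero, mul_one, div_one] at h
  exact h
end
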